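/- Let r be a positive integer and G ⊆ ℝ^N a definable C^r group (a definable C^r submanifold of ℝ^N that is a group whose multiplication G × G → G and inversion G → G are definable C^r maps), and let H be a subgroup of G that is a definable set. Then H is closed in G and H is itself a definable C^r submanifold of ℝ^N. -/

import Mathlib

open FirstOrder Set Topology

namespace Paper

variable (L : FirstOrder.Language) [L.Structure ℝ]

/-- A subset of `ℝⁿ` is definable in the structure (with parameters from `ℝ`). -/
def Def (n : ℕ) (s : Set (Fin n → ℝ)) : Prop :=
  Set.Definable (Set.univ : Set ℝ) L s

/-- A subset of `ℝ` is definable. -/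
def Def1 (s : Set ℝ) : Prop := Def L 1 {x | x 0 ∈ s}

/-- The structure expands the ordered field `(ℝ, <, +, ·, 0, 1)`:
the order and the field operations (and the constants) are definable. -/
def ExpandsOrderedField : Prop :=
  Def L 2 {x | x 0 < x 1} ∧ Def L 3 {x | x 0 + x 1 = x 2} ∧
  Def L 3 {x | x 0 * x 1 = x 2} ∧ Def L 1 {x | x 0 = 0} ∧ Def L 1 {x | x 0 = 1}

/-- Local o-minimality: every definable subset of `ℝ` is, near each point, a finite
union of points and open intervals. -/
def LocallyOMinimal : Prop :=
  ∀ X : Set ℝ, Def1 L X → ∀ a : ℝ,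
    ∃ b c : ℝ, b < a ∧ a < c ∧
      ∃ (P : Finset ℝ) (J : Finset (ℝ × ℝ)),
        X ∩ Set.Ioo b c = ↑P ∪ ⋃ p ∈ J, Set.Ioo p.1 p.2

/-- First component of a point of `ℝ^(m+n) = ℝ^m × ℝ^n`. -/
def fstFun {m n : ℕ} (z : Fin (m + n) → ℝ) : Fin m → ℝ := fun i => z (Fin.castAdd n i)

/-- Second component of a point of `ℝ^(m+n) = ℝ^m × ℝ^n`. -/
def sndFun {m n : ℕ} (z : Fin (m + n) → ℝ) : Fin n → ℝ := fun j => z (Fin.natAdd m j)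

/-- The map `f : X → ℝⁿ`, `X ⊆ ℝ^m`, is definable (its graph over `X` is definable). -/
def DefMapOn (m n : ℕ) (X : Set (Fin m → ℝ)) (f : (Fin m → ℝ) → (Fin n → ℝ)) : Prop :=
  Def L (m + n) {z | fstFun z ∈ X ∧ sndFun z = f (fstFun z)}

/-- The function `f : X → ℝ`, `X ⊆ ℝ^m`, is definable. -/
def DefFunOn (m : ℕ) (X : Set (Fin m → ℝ)) (f : (Fin m → ℝ) → ℝ) : Prop :=
  DefMapOn L m 1 X fun x _ => f x

/-- `f` is of class `C^r` on `X` in the sense that near every point of `X` it agrees on `X`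
with a `C^r` map defined on an open neighborhood in the ambient space. -/
def CrMapOn (r m n : ℕ) (X : Set (Fin m → ℝ)) (f : (Fin m → ℝ) → (Fin n → ℝ)) : Prop :=
  ∀ a ∈ X, ∃ (W : Set (Fin m → ℝ)) (g : (Fin m → ℝ) → (Fin n → ℝ)),
    a ∈ W ∧ IsOpen W ∧ ContDiffOn ℝ r g W ∧ Set.EqOn f g (X ∩ W)

/-- Real-valued version of `CrMapOn`. -/
def CrFunOn (r m : ℕ) (X : Set (Fin m → ℝ)) (f : (Fin m → ℝ) → ℝ) : Prop :=
  ∀ a ∈ X, ∃ (W : Set (Fin m → ℝ)) (g : (Fin m → ℝ) → ℝ),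
    a ∈ W ∧ IsOpen W ∧ ContDiffOn ℝ r g W ∧ Set.EqOn f g (X ∩ W)

/-- A definable `C^r` map `X → ℝⁿ`. -/
def DefCrMapOn (r m n : ℕ) (X : Set (Fin m → ℝ)) (f : (Fin m → ℝ) → (Fin n → ℝ)) : Prop :=
  DefMapOn L m n X f ∧ CrMapOn r m n X f

/-- A definable `C^r` function `X → ℝ`. -/
def DefCrFunOn (r m : ℕ) (X : Set (Fin m → ℝ)) (f : (Fin m → ℝ) → ℝ) : Prop :=
  DefFunOn L m X f ∧ CrFunOn r m X f

/-- A definable `C^r` submanifold of `ℝⁿ` of dimension `d`: around every point there is a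
definable `C^r` chart of `ℝⁿ` straightening `M` to the first `d` coordinates. -/
def IsDefCrSubmanifold (r n d : ℕ) (M : Set (Fin n → ℝ)) : Prop :=
  Def L n M ∧
  ∀ a ∈ M, ∃ (U V : Set (Fin n → ℝ)) (φ ψ : (Fin n → ℝ) → (Fin n → ℝ)),
    a ∈ U ∧ IsOpen U ∧ Def L n U ∧
    (0 : Fin n → ℝ) ∈ V ∧ IsOpen V ∧ Def L n V ∧
    DefMapOn L n n U φ ∧ DefMapOn L n n V ψ ∧
    ContDiffOn ℝ r φ U ∧ ContDiffOn ℝ r ψ V ∧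
    Set.BijOn φ U V ∧ Set.InvOn ψ φ U V ∧
    φ a = 0 ∧
    φ '' (M ∩ U) = {x ∈ V | ∀ i : Fin n, d ≤ (i : ℕ) → x i = 0}

/-- The Euclidean norm on `ℝⁿ`. -/
noncomputable def eunorm {n : ℕ} (x : Fin n → ℝ) : ℝ := Real.sqrt (∑ i, x i ^ 2)

/-- Projection of `ℝⁿ` onto the `d` coordinates selected by `σ`. -/
def coordProj {n : ℕ} (d : ℕ) (σ : Fin d → Fin n) (x : Fin n → ℝ) : Fin d → ℝ :=
  fun i => x (σ i)

/-- `X ⊆ ℝⁿ` has dimension `d`: `d` is the largest integer such that some coordinate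
projection of `X` onto `ℝ^d` has nonempty interior. -/
def HasDim {n : ℕ} (X : Set (Fin n → ℝ)) (d : ℕ) : Prop :=
  (∃ σ : Fin d → Fin n, Function.Injective σ ∧ (interior (coordProj d σ '' X)).Nonempty) ∧
  ∀ (e : ℕ) (σ : Fin e → Fin n), Function.Injective σ →
    (interior (coordProj e σ '' X)).Nonempty → e ≤ d

/-- A (bounded) open box in `ℝⁿ`. -/
def IsOpenBox {n : ℕ} (B : Set (Fin n → ℝ)) : Prop :=
  ∃ a b : Fin n → ℝ, (∀ i, a i < b i) ∧ B = Set.pi Set.univ fun i => Set.Ioo (a i) (b i)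


section Helpers

/-! ### A calculus of definable predicates and maps -/

/-- A set identified with a finite power of `ℝ`. -/
class DefSpace (E : Type) where
  /-- The index set of the coordinates. -/
  ι : Type
  [fin : Finite ι]
  /-- The coordinates. -/
  coords : E ≃ (ι → ℝ)

attribute [instance] DefSpace.fin

open DefSpace

instance : DefSpace ℝ := ⟨Unit, (Equiv.funUnique Unit ℝ).symm⟩

instance (n : ℕ) : DefSpace (Fin n → ℝ) := ⟨Fin n, Equiv.refl _⟩

instance (E F : Type) [DefSpace E] [DefSpace F] : DefSpace (E × F) :=
  ⟨ι E ⊕ ι F, (Equiv.prodCongr coords coords).trans (Equiv.sumArrowEquivProdArrow _ _ _).symm⟩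

variable {E F K : Type} [DefSpace E] [DefSpace F] [DefSpace K]

/-- A predicate is definable. -/
def DP (P : E → Prop) : Prop :=
  (univ : Set ℝ).Definable L {v : ι E → ℝ | P (coords.symm v)}

/-- A map is definable. -/
@[fun_prop]
def DM (f : E → F) : Prop :=
  (univ : Set ℝ).DefinableMap L fun v : ι E → ℝ => coords (f (coords.symm v))

variable {L}

theorem def_iff_dp {n : ℕ} {s : Set (Fin n → ℝ)} : Def L n s ↔ DP L fun x => x ∈ s := Iff.rfl

theorem DP.and {P Q : E → Prop} (hP : DP L P) (hQ : DP L Q) : DP L fun x => P x ∧ Q x :=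
  Set.Definable.inter hP hQ

theorem DP.or {P Q : E → Prop} (hP : DP L P) (hQ : DP L Q) : DP L fun x => P x ∨ Q x :=
  Set.Definable.union hP hQ

theorem DP.not {P : E → Prop} (hP : DP L P) : DP L fun x => ¬ P x :=
  Set.Definable.compl hP

theorem DP.imp {P Q : E → Prop} (hP : DP L P) (hQ : DP L Q) : DP L fun x => P x → Q x := by
  simpa only [imp_iff_not_or] using hP.not.or hQ

theorem DP.iff {P Q : E → Prop} (hP : DP L P) (hQ : DP L Q) : DP L fun x => P x ↔ Q x := by
  simpa only [iff_iff_implies_and_implies] using (hP.imp hQ).and (hQ.imp hP)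

theorem DP.prop (p : Prop) : DP L fun _ : E => p := by
  by_cases h : p
  · simp [DP, h]
  · simp [DP, h]

theorem DP.exists {P : E → F → Prop} (h : DP L fun p : E × F => P p.1 p.2) :
    DP L fun x => ∃ y, P x y := by
  have := Set.Definable.exists_of_finite (α := ι E) (β := ι F) h
  refine (congrArg (Set.Definable univ L) (Set.ext fun v => ?_)).mp this
  exact (coords.exists_congr_left (p := fun y => P (coords.symm v) y)).symm

theorem DP.forall {P : E → F → Prop} (h : DP L fun p : E × F => P p.1 p.2) :
    DP L fun x => ∀ y, P x y := by
  simpa using (DP.exists (P := fun x y => ¬ P x y) h.not).not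

theorem DP.forall_finite {α : Sort*} [Finite α] {P : E → α → Prop} (h : ∀ i, DP L fun x => P x i) :
    DP L fun x => ∀ i, P x i := by
  have := Set.definable_iInter_of_finite (ι := PLift α) (fun i => h i.down)
  refine (congrArg (Set.Definable univ L) (Set.ext fun v => ?_)).mp this
  simp [PLift.forall]

theorem DP.comp {P : F → Prop} {f : E → F} (hP : DP L P) (hf : DM L f) : DP L fun x => P (f x) := by
  have := Set.Definable.preimage_map hf hP
  simpa [DP, Set.preimage] using this

@[fun_prop]
theorem DM.id : DM L fun x : E => x := by
  intro i
  simpa using Set.DefinableFun.proj L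

@[fun_prop]
theorem DM.const (c : F) : DM L fun _ : E => c :=
  fun _ => Language.definableFun_const L _ (mem_univ _)

@[fun_prop]
theorem DM.comp {g : F → K} {f : E → F} (hg : DM L g) (hf : DM L f) : DM L fun x => g (f x) := by
  intro i
  simpa using Set.DefinableFun.comp hf (hg i)

@[fun_prop]
theorem DM.fst : DM L fun p : E × F => p.1 := by
  intro i
  have h := Set.DefinableFun.proj L (A := (univ : Set ℝ)) (i := (Sum.inl i : ι E ⊕ ι F))
  refine (congrArg (Set.DefinableFun L univ) (funext fun v => ?_)).mp h
  exact (congrFun (coords.apply_symm_apply (v ∘ Sum.inl)) i).symm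

@[fun_prop]
theorem DM.snd : DM L fun p : E × F => p.2 := by
  intro i
  have h := Set.DefinableFun.proj L (A := (univ : Set ℝ)) (i := (Sum.inr i : ι E ⊕ ι F))
  refine (congrArg (Set.DefinableFun L univ) (funext fun v => ?_)).mp h
  exact (congrFun (coords.apply_symm_apply (v ∘ Sum.inr)) i).symm

@[fun_prop]
theorem DM.prodMk {f : E → F} {g : E → K} (hf : DM L f) (hg : DM L g) :
    DM L fun x => (f x, g x) := by
  rintro (i | i)
  exacts [hf i, hg i]

@[fun_prop]
theorem DM.apply {n : ℕ} (i : Fin n) : DM L fun x : Fin n → ℝ => x i :=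
  fun _ => Set.DefinableFun.proj L

@[fun_prop]
theorem DM.pi {n : ℕ} {f : E → Fin n → ℝ} (hf : ∀ i, DM L fun x => f x i) : DM L f :=
  fun i => hf i ()

theorem DP.eq {f g : E → F} (hf : DM L f) (hg : DM L g) : DP L fun x => f x = g x := by
  have : DP L fun x => ∀ i, coords (f x) i = coords (g x) i :=
    .forall_finite fun i => Set.DefinableFun.ofPred_eq (hf i) (hg i)
  simpa [← funext_iff] using this

theorem DM.of_graph {f : E → F} (h : DP L fun p : E × F => p.2 = f p.1) : DM L f := by
  intro i
  have h1 : DP L fun p : (E × ℝ) × F => p.2 = f p.1.1 :=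
    h.comp (f := fun p : (E × ℝ) × F => (p.1.1, p.2)) (by fun_prop)
  have h2 : DM L fun y : F => coords y i := fun _ => by simpa using! Set.DefinableFun.proj L
  have h3 : DP L fun p : E × ℝ => ∃ y, y = f p.1 ∧ coords y i = p.2 :=
    .exists (h1.and (.eq (by fun_prop) (by fun_prop)))
  simp only [exists_eq_left] at h3
  exact Set.Definable.preimage_comp (fun j : ι E ⊕ Unit => j.elim some fun _ => none) h3

theorem DM.ite {P : E → Prop} [DecidablePred P] {f g : E → F} (hP : DP L P) (hf : DM L f)
    (hg : DM L g) : DM L fun x => if P x then f x else g x := by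
  refine .of_graph (?_ : DP L _)
  have h : DP L fun p : E × F => (P p.1 ∧ p.2 = f p.1) ∨ (¬ P p.1 ∧ p.2 = g p.1) :=
    .or (.and (hP.comp .fst) (.eq .snd (by fun_prop)))
      (.and (hP.comp .fst).not (.eq .snd (by fun_prop)))
  convert h using 2 with p
  split_ifs <;> simp_all

section Field

variable [hL : Fact (ExpandsOrderedField L)]

theorem DP.lt {f g : E → ℝ} (hf : DM L f) (hg : DM L g) : DP L fun x => f x < g x :=
  DP.comp (def_iff_dp.1 hL.out.1) (f := fun x => ![f x, g x])
    (.pi fun i => by fin_cases i <;> simpa)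

theorem DP.le {f g : E → ℝ} (hf : DM L f) (hg : DM L g) : DP L fun x => f x ≤ g x := by
  simpa using (DP.lt hg hf).not

@[fun_prop]
theorem DM.add {f g : E → ℝ} (hf : DM L f) (hg : DM L g) : DM L fun x => f x + g x := by
  have h : DP L fun p : E × ℝ => f p.1 + g p.1 = p.2 :=
    DP.comp (def_iff_dp.1 hL.out.2.1) (f := fun p : E × ℝ => ![f p.1, g p.1, p.2])
      (.pi fun i => by fin_cases i <;> simp <;> fun_prop)
  exact .of_graph (by simpa only [eq_comm] using h)

@[fun_prop]
theorem DM.mul {f g : E → ℝ} (hf : DM L f) (hg : DM L g) : DM L fun x => f x * g x := by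
  have h : DP L fun p : E × ℝ => f p.1 * g p.1 = p.2 :=
    DP.comp (def_iff_dp.1 hL.out.2.2.1) (f := fun p : E × ℝ => ![f p.1, g p.1, p.2])
      (.pi fun i => by fin_cases i <;> simp <;> fun_prop)
  exact .of_graph (by simpa only [eq_comm] using h)

@[fun_prop]
theorem DM.neg {f : E → ℝ} (hf : DM L f) : DM L fun x => -f x := by
  simpa using (DM.const (-1 : ℝ)).mul hf

@[fun_prop]
theorem DM.sub {f g : E → ℝ} (hf : DM L f) (hg : DM L g) : DM L fun x => f x - g x := by
  simpa only [sub_eq_add_neg] using hf.add hg.neg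

@[fun_prop]
theorem DM.abs {f : E → ℝ} (hf : DM L f) : DM L fun x => |f x| := by
  have : DM L fun x => if 0 ≤ f x then f x else - f x := .ite (.le (.const _) hf) hf hf.neg
  convert this using 2 with x
  split_ifs with h
  exacts [abs_of_nonneg h, abs_of_neg (not_le.1 h)]

end Field

section

/-! ### Definable sets are open or have open complement on an open set -/

theorem LocallyOMinimal.exists_germ (hlom : LocallyOMinimal L) {X : ℝ → Prop} (hX : DP L X)
    (a : ℝ) : ∃ ε > 0, ∃ l r : Prop, (∀ t ∈ Ioo (a - ε) a, X t ↔ l) ∧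
      ∀ t ∈ Ioo a (a + ε), X t ↔ r := by
  obtain ⟨b, c, hb, hc, P, J, h⟩ := hlom {t | X t} (hX.comp (DM.apply 0)) a
  classical
  set S : Finset ℝ := (P ∪ J.image Prod.fst ∪ J.image Prod.snd ∪ {b, c}).erase a with hS
  obtain ⟨ε, hε, hball⟩ := Metric.isOpen_iff.1 S.finite_toSet.isClosed.isOpen_compl a
    (by simp [hS])
  have hfree : ∀ s ∈ P ∪ J.image Prod.fst ∪ J.image Prod.snd ∪ {b, c}, s ≠ a →
      s ≤ a - ε ∨ a + ε ≤ s := by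
    intro s hs hsa
    by_contra! hcon
    exact hball (by rw [Real.ball_eq_Ioo]; exact hcon) (by
      simp only [hS, Finset.mem_coe, Finset.mem_erase]
      exact ⟨hsa, hs⟩)
  have hbε : b ≤ a - ε := (hfree b (by simp) hb.ne).resolve_right (by linarith)
  have hcε : a + ε ≤ c := (hfree c (by simp) hc.ne').resolve_left (by linarith)
  have key : ∀ t t', t ∈ Ioo (a - ε) (a + ε) → t' ∈ Ioo (a - ε) (a + ε) → t ≠ a → t' ≠ a →
      (t < a ↔ t' < a) → X t → X t' := by
    intro t t' ht ht' hta hta' hiff hXt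
    have h1 : t ∈ {t | X t} ∩ Ioo b c := ⟨hXt, by linarith [ht.1], by linarith [ht.2]⟩
    suffices h2 : t' ∈ {t | X t} ∩ Ioo b c from h2.1
    rw [h] at h1 ⊢
    rcases h1 with h1 | h1
    · rcases hfree t (by simp at h1; simp [h1]) hta with h2 | h2
      · linarith [ht.1]
      · linarith [ht.2]
    · right
      simp only [mem_iUnion, exists_prop] at h1 ⊢
      obtain ⟨p, hp, h1, h2⟩ := h1
      refine ⟨p, hp, ?_, ?_⟩
      · by_cases hpa : p.1 = a
        · rw [hpa] at h1 ⊢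
          exact lt_of_le_of_ne (not_lt.1 fun h => absurd (hiff.2 h) h1.le.not_gt) hta'.symm
        · have := hfree p.1 (by simp only [Finset.mem_union, Finset.mem_image]; grind) hpa
          rcases this with h | h <;> linarith [ht.1, ht.2, ht'.1]
      · by_cases hpa : p.2 = a
        · rw [hpa] at h2 ⊢
          exact hiff.1 h2
        · have := hfree p.2 (by simp only [Finset.mem_union, Finset.mem_image]; grind) hpa
          rcases this with h | h <;> linarith [ht.1, ht.2, ht'.2]
  refine ⟨ε, hε, X (a - ε / 2), X (a + ε / 2), fun t ht => ⟨?_, ?_⟩, fun t ht => ⟨?_, ?_⟩⟩ <;>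
  · apply key <;> grind

theorem LocallyOMinimal.exists_rat_interval (hlom : LocallyOMinimal L) {X : ℝ → Prop}
    (hX : DP L X) {a b : ℝ} (hab : a < b) :
    ∃ p q : ℚ, a ≤ p ∧ p < q ∧ q ≤ b ∧ ∃ c : Bool, ∀ t : ℝ, p < t → t < q → (X t ↔ c = true) := by
  classical
  obtain ⟨ε, hε, l, r, -, h⟩ := hlom.exists_germ hX a
  obtain ⟨p, hp1, hp2⟩ := exists_rat_btwn (show a < min b (a + ε) by simp [hab, hε])
  obtain ⟨q, hq1, hq2⟩ := exists_rat_btwn hp2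
  rw [lt_min_iff] at hq2
  refine ⟨p, q, hp1.le, by exact_mod_cast hq1, hq2.1.le, decide r, fun t h1 h2 => ?_⟩
  rw [h t ⟨by linarith, by linarith⟩, decide_eq_true_iff]

theorem LocallyOMinimal.exists_rat_interval_of_nonempty (hlom : LocallyOMinimal L) {X : ℝ → Prop}
    (hX : DP L X) (hne : ∃ t, X t) :
    ∃ p q : ℚ, p < q ∧ ((∀ t : ℝ, p < t → t < q → X t) ∨ ∃! t : ℝ, (p < t ∧ t < q) ∧ X t) := by
  obtain ⟨a, ha⟩ := hne
  obtain ⟨ε, hε, l, r, h1, h2⟩ := hlom.exists_germ hX a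
  obtain ⟨p, hp1, hp2⟩ := exists_rat_btwn (show a - ε < a by linarith)
  obtain ⟨q, hq1, hq2⟩ := exists_rat_btwn (show a < a + ε by linarith)
  by_cases hr : r
  · obtain ⟨p', hp1', hp2'⟩ := exists_rat_btwn hq1
    exact ⟨p', q, by exact_mod_cast hp2', .inl fun t h3 h4 =>
      (h2 t ⟨by linarith, by linarith⟩).2 hr⟩
  by_cases hl : l
  · obtain ⟨q', hq1', hq2'⟩ := exists_rat_btwn hp2
    exact ⟨p, q', by exact_mod_cast hq1', .inl fun t h3 h4 =>
      (h1 t ⟨by linarith, by linarith⟩).2 hl⟩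
  refine ⟨p, q, by exact_mod_cast hp2.trans hq1, .inr ⟨a, ⟨⟨hp2, hq1⟩, ha⟩, ?_⟩⟩
  rintro t ⟨⟨h3, h4⟩, h5⟩
  rcases lt_trichotomy t a with h | h | h
  · exact absurd ((h1 t ⟨by linarith, h⟩).1 h5) hl
  · exact h
  · exact absurd ((h2 t ⟨h, by linarith⟩).1 h5) hr

variable (L) in
/-- Every definable predicate on `ℝⁿ` is constant on some nonempty open subset of any given
nonempty open set. -/
def Decides (n : ℕ) : Prop :=
  ∀ P : (Fin n → ℝ) → Prop, DP L P → ∀ U : Set (Fin n → ℝ), IsOpen U → U.Nonempty →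
    ∃ V ⊆ U, IsOpen V ∧ V.Nonempty ∧ ((∀ x ∈ V, P x) ∨ ∀ x ∈ V, ¬ P x)

theorem Decides.exists_of_countable {n : ℕ} (hdec : Decides L n) {κ : Type*} [Countable κ]
    {D : κ → (Fin n → ℝ) → Prop} (hD : ∀ k, DP L (D k)) {U : Set (Fin n → ℝ)} (hU : IsOpen U)
    (hne : U.Nonempty) (hcov : ∀ x ∈ U, ∃ k, D k x) :
    ∃ k, ∃ V ⊆ U, IsOpen V ∧ V.Nonempty ∧ ∀ x ∈ V, D k x := by
  by_contra! hcon
  refine not_isMeagre_of_isOpen hU hne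
    (IsMeagre.mono (s := ⋃ k, {x | x ∈ U ∧ D k x}) (fun x hx => ?_) (isMeagre_iUnion fun k => ?_))
  · obtain ⟨k, hk⟩ := hcov x hx
    exact mem_iUnion.2 ⟨k, hx, hk⟩
  · refine IsNowhereDense.isMeagre (not_nonempty_iff_eq_empty.1 fun hW => ?_)
    set W := interior (closure {x | x ∈ U ∧ D k x}) with hWdef
    have hdense : ∀ V ⊆ W, IsOpen V → V.Nonempty → ∃ x ∈ V, x ∈ U ∧ D k x := by
      rintro V hVW hV ⟨x, hx⟩
      obtain ⟨y, hy, hy'⟩ := mem_closure_iff.1 (interior_subset (hVW hx)) V hV hx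
      exact ⟨y, hy, hy'⟩
    have hWU : (W ∩ U).Nonempty := by
      obtain ⟨x, hx, hxU, -⟩ := hdense W subset_rfl isOpen_interior hW
      exact ⟨x, hx, hxU⟩
    obtain ⟨V, hV, hVo, hVne, h | h⟩ := hdec _ (hD k) (W ∩ U) (isOpen_interior.inter hU) hWU
    · obtain ⟨x, hx, hx'⟩ := hcon k V (hV.trans inter_subset_right) hVo hVne
      exact hx' (h x hx)
    · obtain ⟨x, hx, -, hx'⟩ := hdense V (hV.trans inter_subset_left) hVo hVne
      exact h x hx hx'

@[fun_prop]
theorem DM.snoc {n : ℕ} {f : E → Fin n → ℝ} {g : E → ℝ} (hf : DM L f) (hg : DM L g) :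
    DM L fun x => (Fin.snoc (f x) (g x) : Fin (n + 1) → ℝ) :=
  .pi fun i => by
    refine Fin.lastCases ?_ (fun i => ?_) i
    · simpa using hg
    · simpa using DM.comp (DM.apply i) hf

@[fun_prop]
theorem DM.init {n : ℕ} {f : E → Fin (n + 1) → ℝ} (hf : DM L f) :
    DM L fun x => (Fin.init (f x) : Fin n → ℝ) :=
  .pi fun i => DM.comp (DM.apply i.castSucc) hf

@[fun_prop]
theorem DM.update {n : ℕ} {i : Fin n} {f : E → Fin n → ℝ} {g : E → ℝ} (hf : DM L f)
    (hg : DM L g) : DM L fun x => Function.update (f x) i (g x) :=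
  .pi fun j => by
    by_cases h : j = i
    · subst h
      simpa using hg
    · simpa [h] using DM.comp (DM.apply j) hf

theorem exists_snoc_mem {n : ℕ} {U : Set (Fin (n + 1) → ℝ)} (hU : IsOpen U) (hne : U.Nonempty) :
    ∃ W : Set (Fin n → ℝ), IsOpen W ∧ W.Nonempty ∧ ∃ a b : ℝ, a < b ∧
      ∀ y ∈ W, ∀ t ∈ Ioo a b, (Fin.snoc y t : Fin (n + 1) → ℝ) ∈ U := by
  obtain ⟨x, hx⟩ := hne
  have hcont : Continuous fun p : (Fin n → ℝ) × ℝ => (Fin.snoc p.1 p.2 : Fin (n + 1) → ℝ) :=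
    .finSnoc (A := fun _ => ℝ) continuous_fst continuous_snd
  obtain ⟨W, T, hW, hT, hxW, hxT, hWT⟩ := isOpen_prod_iff.1 (hU.preimage hcont) (Fin.init x)
    (x (Fin.last n)) (by simpa using hx)
  obtain ⟨a, b, hab, habT⟩ := mem_nhds_iff_exists_Ioo_subset.1 (hT.mem_nhds hxT)
  exact ⟨W, hW, ⟨_, hxW⟩, a, b, hab.1.trans hab.2, fun y hy t ht => @hWT (y, t) ⟨hy, habT ht⟩⟩

variable [hL : Fact (ExpandsOrderedField L)]

theorem LocallyOMinimal.decides (hlom : LocallyOMinimal L) (n : ℕ) : Decides L n := by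
  induction n with
  | zero =>
    intro P hP U hU hne
    refine ⟨U, subset_rfl, hU, hne, ?_⟩
    by_cases h : P 0
    · exact .inl fun x _ => by rwa [Subsingleton.elim x 0]
    · exact .inr fun x _ => by rwa [Subsingleton.elim x 0]
  | succ n ih =>
    intro P hP U hU hne
    obtain ⟨W, hW, hWne, a, b, hab, hWU⟩ := exists_snoc_mem hU hne
    let D : ℚ × ℚ × Bool → (Fin n → ℝ) → Prop := fun k y => (a ≤ k.1 ∧ k.1 < k.2.1 ∧ k.2.1 ≤ b) ∧
      ∀ t : ℝ, k.1 < t → t < k.2.1 → (P (Fin.snoc y t) ↔ k.2.2 = true)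
    have hD : ∀ k, DP L (D k) := fun k => .and (.prop _) (.forall (.imp (.lt (.const _) .snd)
      (.imp (.lt .snd (.const _)) (.iff (hP.comp (by fun_prop)) (.prop _)))))
    obtain ⟨⟨p, q, c⟩, V, hVW, hV, hVne, hVD⟩ := ih.exists_of_countable hD hW hWne fun y _ => by
      obtain ⟨p, q, h1, h2, h3, c, h4⟩ := hlom.exists_rat_interval
        (X := fun t => P (Fin.snoc y t)) (hP.comp (by fun_prop)) hab
      exact ⟨(p, q, c), ⟨h1, h2, h3⟩, h4⟩
    obtain ⟨y, hy⟩ := hVne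
    obtain ⟨⟨h1, h2, h3⟩, -⟩ := hVD y hy
    dsimp only at h1 h2 h3
    have h2' : (p : ℝ) < q := by exact_mod_cast h2
    refine ⟨{x | Fin.init x ∈ V ∧ x (Fin.last n) ∈ Ioo (p : ℝ) q}, fun x hx => ?_,
      (hV.preimage (by fun_prop)).inter (isOpen_Ioo.preimage (continuous_apply _)),
      ⟨Fin.snoc y ((p + q) / 2 : ℝ), ?_⟩, ?_⟩
    · simpa using hWU _ (hVW hx.1) (x (Fin.last n)) ⟨h1.trans_lt hx.2.1, hx.2.2.trans_le h3⟩
    · simp [hy]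
      constructor <;> linarith
    · have key : ∀ x : Fin (n + 1) → ℝ, (Fin.init x ∈ V ∧ x (Fin.last n) ∈ Ioo (p : ℝ) q) →
          (P x ↔ c = true) := fun x hx => by
        simpa using (hVD _ hx.1).2 _ hx.2.1 hx.2.2
      cases c
      · exact .inr fun x hx => by simpa using key x hx
      · exact .inl fun x hx => by simpa using key x hx

end

section

variable [hL : Fact (ExpandsOrderedField L)]

/-! ### Generic smoothness of definable functions -/

theorem DP.eventually_nhds {n : ℕ} {P : E → (Fin n → ℝ) → Prop} {g : E → Fin n → ℝ}
    (hP : DP L fun p : E × (Fin n → ℝ) => P p.1 p.2) (hg : DM L g) :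
    DP L fun x => ∀ᶠ y in 𝓝 (g x), P x y := by
  have : DP L fun x => ∃ δ : ℝ, 0 < δ ∧ ∀ y : Fin n → ℝ, (∀ i, |y i - g x i| < δ) → P x y :=
    .exists (.and (.lt (.const _) .snd) (.forall (.imp (.forall_finite fun i =>
      .lt (by fun_prop) (by fun_prop)) (hP.comp (f := fun p : (E × ℝ) × (Fin n → ℝ) =>
        (p.1.1, p.2)) (by fun_prop)))))
  convert this using 2 with x
  rw [Metric.eventually_nhds_iff]
  refine exists_congr fun δ => and_congr_right fun hδ => forall_congr' fun y => ?_
  rw [dist_pi_lt_iff hδ]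
  rfl

theorem DP.eventually_nhds_real {P : E → ℝ → Prop} {g : E → ℝ}
    (hP : DP L fun p : E × ℝ => P p.1 p.2) (hg : DM L g) :
    DP L fun x => ∀ᶠ y in 𝓝 (g x), P x y := by
  have : DP L fun x => ∃ δ : ℝ, 0 < δ ∧ ∀ y : ℝ, |y - g x| < δ → P x y :=
    .exists (.and (.lt (.const _) .snd) (.forall (.imp (.lt (by fun_prop) (by fun_prop))
      (hP.comp (f := fun p : (E × ℝ) × ℝ => (p.1.1, p.2)) (by fun_prop)))))
  convert this using 2 with x
  rw [Metric.eventually_nhds_iff]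
  rfl

theorem DP.continuousAt {n : ℕ} {f : (Fin n → ℝ) → ℝ} (hf : DM L f) :
    DP L fun x => ContinuousAt f x := by
  have : DP L fun x => ∀ ε : ℝ, 0 < ε → ∀ᶠ y in 𝓝 x, |f y - f x| < ε :=
    .forall (.imp (.lt (by fun_prop) (by fun_prop)) (.eventually_nhds
      (.lt (by fun_prop) (by fun_prop)) (by fun_prop)))
  simpa only [ContinuousAt, Metric.tendsto_nhds, Real.dist_eq] using this

theorem DP.hasDerivAt {h : E → ℝ → ℝ} {c a : E → ℝ} (hh : DM L fun p : E × ℝ => h p.1 p.2)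
    (hc : DM L c) (ha : DM L a) : DP L fun x => HasDerivAt (h x) (c x) (a x) := by
  have h1 : DM L fun p : (E × ℝ) × ℝ => h p.1.1 p.2 :=
    hh.comp (f := fun p : (E × ℝ) × ℝ => (p.1.1, p.2)) (by fun_prop)
  have h2 : DM L fun p : (E × ℝ) × ℝ => h p.1.1 (a p.1.1) :=
    hh.comp (f := fun p : (E × ℝ) × ℝ => (p.1.1, a p.1.1)) (by fun_prop)
  have : DP L fun x => ∀ ε : ℝ, 0 < ε →
      ∀ᶠ y in 𝓝 (a x), |h x y - h x (a x) - (y - a x) * c x| ≤ ε * |y - a x| :=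
    .forall (.imp (.lt (by fun_prop) (by fun_prop)) (.eventually_nhds_real
      (.le (by fun_prop) (by fun_prop)) (by fun_prop)))
  simpa only [hasDerivAt_iff_isLittleO, Asymptotics.isLittleO_iff, Real.norm_eq_abs,
    smul_eq_mul] using this

theorem DM.deriv {h : E → ℝ → ℝ} {a : E → ℝ} (hh : DM L fun p : E × ℝ => h p.1 p.2)
    (ha : DM L a) : DM L fun x => deriv (h x) (a x) := by
  have h1 : DM L fun p : (E × ℝ) × ℝ => h p.1.1 p.2 :=
    hh.comp (f := fun p : (E × ℝ) × ℝ => (p.1.1, p.2)) (by fun_prop)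
  have h2 : DM L fun p : ((E × ℝ) × ℝ) × ℝ => h p.1.1.1 p.2 :=
    hh.comp (f := fun p : ((E × ℝ) × ℝ) × ℝ => (p.1.1.1, p.2)) (by fun_prop)
  have : DP L fun p : E × ℝ => HasDerivAt (h p.1) p.2 (a p.1) ∨
      (¬ ∃ c, HasDerivAt (h p.1) c (a p.1)) ∧ p.2 = 0 :=
    .or (.hasDerivAt (h := fun p : E × ℝ => h p.1) h1 (by fun_prop) (by fun_prop))
      (.and (.not (.exists (.hasDerivAt (h := fun p : (E × ℝ) × ℝ => h p.1.1) h2 (by fun_prop)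
        (by fun_prop)))) (.eq (by fun_prop) (by fun_prop)))
  refine .of_graph ?_
  convert this using 2 with p
  by_cases hd : DifferentiableAt ℝ (h p.1) (a p.1)
  · have hex : ∃ c, HasDerivAt (h p.1) c (a p.1) := ⟨_, hd.hasDerivAt⟩
    simp only [hex, not_true_eq_false, false_and, or_false]
    exact ⟨fun h => h ▸ hd.hasDerivAt, fun h => h.deriv.symm⟩
  · have hex : ∀ c, ¬ HasDerivAt (h p.1) c (a p.1) := fun c hc => hd hc.differentiableAt
    simp [hex, deriv_zero_of_not_differentiableAt hd]

theorem LocallyOMinimal.exists_interval (hlom : LocallyOMinimal L) {κ : Type*} [Countable κ]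
    {D : κ → ℝ → Prop} (hD : ∀ k, DP L (D k)) {a b : ℝ} (hab : a < b)
    (hcov : ∀ x ∈ Ioo a b, ∃ k, D k x) :
    ∃ k, ∃ c d : ℝ, a ≤ c ∧ c < d ∧ d ≤ b ∧ ∀ x ∈ Ioo c d, D k x := by
  have hU : IsOpen {x : Fin 1 → ℝ | x 0 ∈ Ioo a b} := isOpen_Ioo.preimage (continuous_apply 0)
  obtain ⟨k, V, hVU, hV, ⟨v, hv⟩, h⟩ := (hlom.decides 1).exists_of_countable
    (D := fun k x => D k (x 0)) (fun k => (hD k).comp (by fun_prop)) hU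
    ⟨fun _ => (a + b) / 2, by constructor <;> linarith⟩ fun x hx => hcov _ hx
  have hcont : Continuous fun t : ℝ => (fun _ => t : Fin 1 → ℝ) := by fun_prop
  have hv' : (fun _ => v 0 : Fin 1 → ℝ) ∈ V := by
    convert hv using 1
    ext i
    rw [Subsingleton.elim i 0]
  obtain ⟨c, d, hcd, hsub⟩ := mem_nhds_iff_exists_Ioo_subset.1
    ((hV.preimage hcont).mem_nhds hv')
  have hlt := hcd.1.trans hcd.2
  have hsub' : Ioo c d ⊆ Ioo a b := fun x hx => hVU (hsub hx)
  obtain ⟨h1, h2⟩ := (Ioo_subset_Ioo_iff hlt).1 hsub'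
  exact ⟨k, c, d, h1, hlt, h2, fun x hx => h _ (hsub hx)⟩

theorem LocallyOMinimal.exists_monotoneOn (hlom : LocallyOMinimal L) {f : ℝ → ℝ} (hf : DM L f)
    {a b : ℝ} (hab : a < b) : ∃ c d : ℝ, a ≤ c ∧ c < d ∧ d ≤ b ∧
      (MonotoneOn f (Ioo c d) ∨ MonotoneOn (-f) (Ioo c d)) := by
  let D : ℕ × Bool → ℝ → Prop := fun k x =>
    ∀ y, x < y → y < x + 1 / ((k.1 : ℝ) + 1) → if k.2 then f x ≤ f y else f y ≤ f x
  have hD : ∀ k, DP L (D k) := by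
    rintro ⟨m, _ | _⟩
    all_goals
      exact .forall (.imp (.lt (by fun_prop) (by fun_prop)) (.imp (.lt (by fun_prop)
        (by fun_prop)) (.le (by fun_prop) (by fun_prop))))
  obtain ⟨⟨m, s⟩, c, d, hac, hcd, hdb, h⟩ := hlom.exists_interval hD hab fun x _ => by
    obtain ⟨ε, hε, -, r, -, hr⟩ := hlom.exists_germ (X := fun t => f x ≤ f t)
      (.le (by fun_prop) (by fun_prop)) x
    obtain ⟨m, hm⟩ := exists_nat_one_div_lt hε
    by_cases h : r
    · exact ⟨(m, true), fun y hy hy' => (hr y ⟨hy, by dsimp at hy'; linarith⟩).2 h⟩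
    · exact ⟨(m, false), fun y hy hy' => (not_le.1 fun hle =>
        h ((hr y ⟨hy, by dsimp at hy'; linarith⟩).1 hle)).le⟩
  have hm : 0 < 1 / ((m : ℝ) + 1) := by positivity
  refine ⟨c, min d (c + 1 / ((m : ℝ) + 1)), hac, lt_min hcd (by linarith),
    (min_le_left _ _).trans hdb, ?_⟩
  have key : ∀ x ∈ Ioo c (min d (c + 1 / ((m : ℝ) + 1))),
      ∀ y ∈ Ioo c (min d (c + 1 / ((m : ℝ) + 1))), x < y →
      if s then f x ≤ f y else f y ≤ f x := by
    intro x hx y hy hxy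
    refine h x ⟨hx.1, hx.2.trans_le (min_le_left _ _)⟩ y hxy ?_
    have := hy.2.trans_le (min_le_right _ _)
    dsimp only
    linarith [hx.1]
  cases s
  · refine .inr fun x hx y hy hxy => ?_
    rcases hxy.eq_or_lt with rfl | hxy
    · exact le_rfl
    · simpa using key x hx y hy hxy
  · refine .inl fun x hx y hy hxy => ?_
    rcases hxy.eq_or_lt with rfl | hxy
    · exact le_rfl
    · simpa using key x hx y hy hxy

theorem exists_differentiableAt_of_monotoneOn {f : ℝ → ℝ} {c d : ℝ} (hcd : c < d)
    (hf : MonotoneOn f (Ioo c d)) : ∃ x ∈ Ioo c d, DifferentiableAt ℝ f x := by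
  have : (MeasureTheory.ae (MeasureTheory.volume.restrict (Ioo c d))).NeBot := by
    rw [MeasureTheory.ae_neBot, Ne, MeasureTheory.Measure.restrict_eq_zero]
    simpa using hcd
  obtain ⟨x, hx, hxm⟩ := ((hf.ae_differentiableWithinAt measurableSet_Ioo).and
    (MeasureTheory.ae_restrict_mem measurableSet_Ioo)).exists
  exact ⟨x, hxm, hx.differentiableAt (isOpen_Ioo.mem_nhds hxm)⟩

theorem LocallyOMinimal.exists_differentiableAt (hlom : LocallyOMinimal L) {f : ℝ → ℝ}
    (hf : DM L f) {a b : ℝ} (hab : a < b) : ∃ x ∈ Ioo a b, DifferentiableAt ℝ f x := by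
  obtain ⟨c, d, hac, hcd, hdb, h | h⟩ := hlom.exists_monotoneOn hf hab
  · obtain ⟨x, hx, hx'⟩ := exists_differentiableAt_of_monotoneOn hcd h
    exact ⟨x, Ioo_subset_Ioo hac hdb hx, hx'⟩
  · obtain ⟨x, hx, hx'⟩ := exists_differentiableAt_of_monotoneOn hcd h
    exact ⟨x, Ioo_subset_Ioo hac hdb hx, by simpa using hx'.neg⟩

theorem LocallyOMinimal.exists_continuousOn (hlom : LocallyOMinimal L) {n : ℕ}
    {f : (Fin n → ℝ) → ℝ} (hf : DM L f) {U : Set (Fin n → ℝ)} (hU : IsOpen U)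
    (hne : U.Nonempty) : ∃ V ⊆ U, IsOpen V ∧ V.Nonempty ∧ ContinuousOn f V := by
  obtain ⟨V, hVU, hV, hVne, h | h⟩ := hlom.decides n _ (.continuousAt hf) U hU hne
  · exact ⟨V, hVU, hV, hVne, fun x hx => (h x hx).continuousWithinAt⟩
  exfalso
  let D : ℚ × Bool → (Fin n → ℝ) → Prop := fun k x =>
    if k.2 then k.1 < f x ∧ ¬ ∀ᶠ y in 𝓝 x, k.1 < f y else f x < k.1 ∧ ¬ ∀ᶠ y in 𝓝 x, f y < k.1
  have hD : ∀ k, DP L (D k) := by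
    rintro ⟨q, _ | _⟩
    all_goals
      exact .and (.lt (by fun_prop) (by fun_prop)) (.not (.eventually_nhds
        (.lt (by fun_prop) (by fun_prop)) (by fun_prop)))
  obtain ⟨⟨q, s⟩, W, -, hW, ⟨x, hx⟩, hWD⟩ := (hlom.decides n).exists_of_countable hD hV hVne
    fun x hx => by
      by_contra! hcon
      refine h x hx (tendsto_order.2 ⟨fun c hc => ?_, fun c hc => ?_⟩)
      · obtain ⟨q, hq1, hq2⟩ := exists_rat_btwn hc
        have := hcon (q, true)
        simp only [D, if_true, hq2, true_and, not_not] at this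
        exact this.mono fun y hy => hq1.trans hy
      · obtain ⟨q, hq1, hq2⟩ := exists_rat_btwn hc
        have := hcon (q, false)
        simp only [D, if_false, Bool.false_eq_true, hq1, true_and, not_not] at this
        exact this.mono fun y hy => hy.trans hq2
  cases s
  · have := hWD x hx
    simp only [D, if_false, Bool.false_eq_true] at this
    refine this.2 (Filter.eventually_of_mem (hW.mem_nhds hx) fun y hy => ?_)
    have := hWD y hy
    simp only [D, if_false, Bool.false_eq_true] at this
    exact this.1
  · have := hWD x hx
    simp only [D, if_true] at this
    refine this.2 (Filter.eventually_of_mem (hW.mem_nhds hx) fun y hy => ?_)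
    have := hWD y hy
    simp only [D, if_true] at this
    exact this.1

theorem LocallyOMinimal.exists_partial (hlom : LocallyOMinimal L) {n : ℕ}
    {f : (Fin n → ℝ) → ℝ} (hf : DM L f) (i : Fin n) {U : Set (Fin n → ℝ)} (hU : IsOpen U)
    (hne : U.Nonempty) : ∃ V ⊆ U, IsOpen V ∧ V.Nonempty ∧
      ∀ x ∈ V, DifferentiableAt ℝ (fun t => f (Function.update x i t)) (x i) := by
  have hT : DP L fun x : Fin n → ℝ => ∃ c, HasDerivAt (fun t => f (Function.update x i t)) c (x i) :=
    .exists (.hasDerivAt (by fun_prop) (by fun_prop) (by fun_prop))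
  obtain ⟨V, hVU, hV, hVne, h | h⟩ := hlom.decides n _ hT U hU hne
  · exact ⟨V, hVU, hV, hVne, fun x hx => (h x hx).choose_spec.differentiableAt⟩
  exfalso
  obtain ⟨x, hx⟩ := hVne
  have hcont : Continuous fun t : ℝ => Function.update x i t := by fun_prop
  obtain ⟨a, b, hab, hsub⟩ := mem_nhds_iff_exists_Ioo_subset.1
    ((hV.preimage hcont).mem_nhds (x := x i) (by simpa))
  obtain ⟨t, ht, hdt⟩ := hlom.exists_differentiableAt (f := fun t => f (Function.update x i t))
    (by fun_prop) (hab.1.trans hab.2)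
  exact h _ (hsub ht) ⟨_, by simpa only [Function.update_idem, Function.update_self] using hdt.hasDerivAt⟩

theorem hasFDerivAt_of_partial {n : ℕ} {f : (Fin n → ℝ) → ℝ} {g : Fin n → (Fin n → ℝ) → ℝ}
    {V : Set (Fin n → ℝ)} (hV : IsOpen V)
    (hf : ∀ y ∈ V, ∀ i, HasDerivAt (fun t => f (Function.update y i t)) (g i y) (y i))
    (hg : ∀ i, ContinuousOn (g i) V) {x : Fin n → ℝ} (hx : x ∈ V) :
    HasFDerivAt f (∑ i, g i x • (ContinuousLinearMap.proj i : (Fin n → ℝ) →L[ℝ] ℝ)) x := by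
  classical
  rw [hasFDerivAt_iff_isLittleO, Asymptotics.isLittleO_iff]
  intro ε hε
  set η := ε / (n + 1) with hη
  have hη0 : 0 < η := by positivity
  have hev : ∀ᶠ y in 𝓝 x, y ∈ V ∧ ∀ i, |g i y - g i x| < η :=
    (hV.eventually_mem hx).and (Filter.eventually_all.2 fun i =>
      Metric.tendsto_nhds.1 ((hg i).continuousAt (hV.mem_nhds hx)) η hη0)
  obtain ⟨δ, hδ, hball⟩ := Metric.eventually_nhds_iff.1 hev
  refine Metric.eventually_nhds_iff.2 ⟨δ, hδ, fun y hy => ?_⟩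
  have key : ∀ s : Finset (Fin n), |f (s.piecewise y x) - f x - ∑ i ∈ s, g i x * (y i - x i)| ≤
      s.card * (η * ‖y - x‖) := by
    intro s
    induction s using Finset.induction_on with
    | empty => simp
    | insert i s hi ih =>
      set p := s.piecewise y x with hp
      have hpi : p i = x i := by simp [hp, hi]
      rw [Finset.piecewise_insert, Finset.sum_insert hi, Finset.card_insert_of_notMem hi]
      have hmem : ∀ t ∈ uIcc (x i) (y i), dist (Function.update p i t) x < δ := by
        intro t ht
        rw [dist_pi_lt_iff hδ] at hy ⊢
        intro j
        by_cases hj : j = i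
        · subst hj
          rw [Function.update_self, Real.dist_eq]
          exact (abs_sub_left_of_mem_uIcc ht).trans_lt (by simpa [Real.dist_eq] using hy j)
        · rw [Function.update_of_ne hj]
          by_cases hjs : j ∈ s
          · simpa [hp, hjs] using hy j
          · simpa [hp, hjs] using hδ
      have hmvt := Convex.norm_image_sub_le_of_norm_hasDerivWithin_le
        (f := fun t => f (Function.update p i t) - g i x * t)
        (f' := fun t => g i (Function.update p i t) - g i x) (s := uIcc (x i) (y i)) (C := η)
        (x := x i) (y := y i) (fun t ht => by
          have h1 := hf _ (hball (hmem t ht)).1 i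
          simp only [Function.update_idem, Function.update_self] at h1
          simpa using! (h1.sub ((hasDerivAt_id t).const_mul (g i x))).hasDerivWithinAt)
        (fun t ht => ((hball (hmem t ht)).2 i).le) (convex_uIcc _ _) left_mem_uIcc right_mem_uIcc
      have hupd : Function.update p i (x i) = p := by rw [← hpi, Function.update_eq_self]
      simp only [hupd, Real.norm_eq_abs] at hmvt
      have hnorm : |y i - x i| ≤ ‖y - x‖ := norm_le_pi_norm (y - x) i
      have hmul := mul_le_mul_of_nonneg_left hnorm hη0.le
      calc |f (Function.update p i (y i)) - f x - (g i x * (y i - x i)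
              + ∑ j ∈ s, g j x * (y j - x j))|
          = |(f (Function.update p i (y i)) - g i x * y i - (f p - g i x * x i)) +
              (f p - f x - ∑ j ∈ s, g j x * (y j - x j))| := by ring_nf
        _ ≤ η * ‖y - x‖ + s.card * (η * ‖y - x‖) :=
            (abs_add_le _ _).trans (add_le_add (hmvt.trans hmul) ih)
        _ = _ := by push_cast; ring
  have h := key Finset.univ
  simp only [Finset.piecewise_univ, Finset.card_univ, Fintype.card_fin] at h
  have hle : (n : ℝ) * (η * ‖y - x‖) ≤ ε * ‖y - x‖ := by
    rw [← mul_assoc]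
    refine mul_le_mul_of_nonneg_right ?_ (norm_nonneg _)
    rw [hη, mul_div_assoc', div_le_iff₀ (by positivity)]
    nlinarith
  simpa using h.trans hle

theorem exists_open_forall_finset {X α : Type*} [TopologicalSpace X] {Q : α → Set X → Prop}
    (hmono : ∀ i V W, V ⊆ W → Q i W → Q i V)
    (hex : ∀ i (U : Set X), IsOpen U → U.Nonempty → ∃ V ⊆ U, IsOpen V ∧ V.Nonempty ∧ Q i V)
    (s : Finset α) {U : Set X} (hU : IsOpen U) (hne : U.Nonempty) :
    ∃ V ⊆ U, IsOpen V ∧ V.Nonempty ∧ ∀ i ∈ s, Q i V := by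
  classical
  induction s using Finset.induction_on with
  | empty => exact ⟨U, subset_rfl, hU, hne, by simp⟩
  | insert i s hi ih =>
    obtain ⟨V, hVU, hV, hVne, h⟩ := ih
    obtain ⟨W, hWV, hW, hWne, h'⟩ := hex i V hV hVne
    exact ⟨W, hWV.trans hVU, hW, hWne, Finset.forall_mem_insert _ _ _ |>.2
      ⟨h', fun j hj => hmono j _ _ hWV (h j hj)⟩⟩

theorem LocallyOMinimal.exists_contDiffOn (hlom : LocallyOMinimal L) {n : ℕ} (r : ℕ)
    {f : (Fin n → ℝ) → ℝ} (hf : DM L f) {U : Set (Fin n → ℝ)} (hU : IsOpen U)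
    (hne : U.Nonempty) : ∃ V ⊆ U, IsOpen V ∧ V.Nonempty ∧ ContDiffOn ℝ r f V := by
  induction r generalizing f U with
  | zero => simpa using hlom.exists_continuousOn hf hU hne
  | succ r ih =>
    let g : Fin n → (Fin n → ℝ) → ℝ := fun i x => deriv (fun t => f (Function.update x i t)) (x i)
    have hg : ∀ i, DM L (g i) := fun i => .deriv (by fun_prop) (by fun_prop)
    obtain ⟨V, hVU, hV, hVne, hd⟩ := exists_open_forall_finset
      (Q := fun i V => (∀ x ∈ V, DifferentiableAt ℝ (fun t => f (Function.update x i t)) (x i)) ∧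
        ContDiffOn ℝ r (g i) V)
      (fun i V W hVW h => ⟨fun x hx => h.1 x (hVW hx), h.2.mono hVW⟩)
      (fun i U hU hne => by
        obtain ⟨V, hVU, hV, hVne, h⟩ := hlom.exists_partial hf i hU hne
        obtain ⟨W, hWV, hW, hWne, h'⟩ := ih (hg i) hV hVne
        exact ⟨W, hWV.trans hVU, hW, hWne, fun x hx => h x (hWV hx), h'⟩) Finset.univ hU hne
    refine ⟨V, hVU, hV, hVne, ?_⟩
    push_cast
    rw [contDiffOn_succ_iff_hasFDerivWithinAt_of_uniqueDiffOn hV.uniqueDiffOn]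
    refine ⟨fun h => by simp at h, fun x => ∑ i, g i x • ContinuousLinearMap.proj i, ?_,
      fun x hx => (hasFDerivAt_of_partial hV (fun y hy i => ((hd i (Finset.mem_univ i)).1 y
        hy).hasDerivAt) (fun i => (hd i (Finset.mem_univ i)).2.continuousOn) hx).hasFDerivWithinAt⟩
    exact ContDiffOn.sum fun i _ => (hd i (Finset.mem_univ i)).2.smul contDiffOn_const

end

section

/-! ### Straightening a definable set near some point -/

variable (L) in
/-- A definable `C^r` diffeomorphism between definable open subsets of `ℝⁿ`. -/
structure DefDiffeo (r : ℕ) {n : ℕ} (e : OpenPartialHomeomorph (Fin n → ℝ) (Fin n → ℝ)) :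
    Prop where
  source : DP L fun x => x ∈ e.source
  target : DP L fun x => x ∈ e.target
  map : DM L e
  map_symm : DM L e.symm
  contDiffOn : ContDiffOn ℝ r e e.source
  contDiffOn_symm : ContDiffOn ℝ r e.symm e.target

namespace DefDiffeo

variable {r n : ℕ} {e e' : OpenPartialHomeomorph (Fin n → ℝ) (Fin n → ℝ)}

theorem refl : DefDiffeo L r (OpenPartialHomeomorph.refl (Fin n → ℝ)) where
  source := .prop True
  target := .prop True
  map := .id
  map_symm := .id
  contDiffOn := contDiffOn_id
  contDiffOn_symm := contDiffOn_id

theorem symm (h : DefDiffeo L r e) : DefDiffeo L r e.symm where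
  source := h.target
  target := h.source
  map := h.map_symm
  map_symm := by simpa using h.map
  contDiffOn := h.contDiffOn_symm
  contDiffOn_symm := by simpa using h.contDiffOn

theorem trans (h : DefDiffeo L r e) (h' : DefDiffeo L r e') : DefDiffeo L r (e.trans e') where
  source := by
    simp only [OpenPartialHomeomorph.trans_source]
    exact h.source.and (h'.source.comp h.map)
  target := by
    simp only [OpenPartialHomeomorph.trans_target]
    exact h'.target.and (h.target.comp h'.map_symm)
  map := h'.map.comp h.map
  map_symm := h.map_symm.comp h'.map_symm
  contDiffOn := by
    rw [OpenPartialHomeomorph.trans_source]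
    exact h'.contDiffOn.comp (h.contDiffOn.mono inter_subset_left) fun x hx => hx.2
  contDiffOn_symm := by
    rw [OpenPartialHomeomorph.trans_target]
    exact h.contDiffOn_symm.comp (h'.contDiffOn_symm.mono inter_subset_left) fun x hx => hx.2

end DefDiffeo

theorem contDiffOn_snoc {F : Type*} [NormedAddCommGroup F] [NormedSpace ℝ F] {r : WithTop ℕ∞}
    {n : ℕ} {s : Set F} {f : F → Fin n → ℝ} {g : F → ℝ}
    (hf : ContDiffOn ℝ r f s) (hg : ContDiffOn ℝ r g s) :
    ContDiffOn ℝ r (fun x => (Fin.snoc (f x) (g x) : Fin (n + 1) → ℝ)) s := by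
  rw [contDiffOn_pi] at hf ⊢
  intro i
  refine Fin.lastCases ?_ (fun i => ?_) i
  · simpa using hg
  · simpa using hf i

theorem contDiff_init {r : WithTop ℕ∞} {n : ℕ} :
    ContDiff ℝ r fun x : Fin (n + 1) → ℝ => (Fin.init x : Fin n → ℝ) :=
  contDiff_pi.2 fun i => contDiff_apply ℝ ℝ i.castSucc

theorem contDiff_last {r : WithTop ℕ∞} {n : ℕ} :
    ContDiff ℝ r fun x : Fin (n + 1) → ℝ => x (Fin.last n) :=
  contDiff_apply ℝ ℝ (Fin.last n)

/-- Set the coordinates in `S` to zero. -/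
def zeroOn {n : ℕ} (S : Finset (Fin n)) (v : Fin n → ℝ) : Fin n → ℝ :=
  fun i => if i ∈ S then 0 else v i

@[fun_prop]
theorem DM.zeroOn {n : ℕ} {S : Finset (Fin n)} {f : E → Fin n → ℝ} (hf : DM L f) :
    DM L fun x => zeroOn S (f x) :=
  .pi fun i => by
    by_cases h : i ∈ S
    · simpa [Paper.zeroOn, h] using DM.const 0
    · simpa [Paper.zeroOn, h] using DM.comp (DM.apply i) hf

theorem contDiff_zeroOn {r : WithTop ℕ∞} {n : ℕ} (S : Finset (Fin n)) :
    ContDiff ℝ r (zeroOn S) :=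
  contDiff_pi.2 fun i => by
    by_cases h : i ∈ S
    · simpa [zeroOn, h] using contDiff_const
    · simpa [zeroOn, h] using contDiff_apply ℝ ℝ i

theorem zeroOn_eq_self {n : ℕ} {S : Finset (Fin n)} {v : Fin n → ℝ} (h : ∀ i ∈ S, v i = 0) :
    zeroOn S v = v := by
  ext i
  by_cases hi : i ∈ S <;> simp [zeroOn, hi, h]

theorem zeroOn_apply_mem {n : ℕ} {S : Finset (Fin n)} {v : Fin n → ℝ} {i : Fin n} (hi : i ∈ S) :
    zeroOn S v i = 0 := by
  simp [zeroOn, hi]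

theorem zeroOn_add_sub_zeroOn {n : ℕ} {S : Finset (Fin n)} {v : Fin n → ℝ} (w : Fin n → ℝ)
    (h : ∀ i ∈ S, v i = 0) : zeroOn S (v + (w - zeroOn S w)) = v := by
  ext i
  by_cases hi : i ∈ S <;> simp [zeroOn, hi, h]

variable [hL : Fact (ExpandsOrderedField L)]

theorem DP.mem_ball {n : ℕ} (x : Fin n → ℝ) {δ : ℝ} (hδ : 0 < δ) :
    DP L fun y => y ∈ Metric.ball x δ := by
  have : DP L fun y : Fin n → ℝ => ∀ i, |y i - x i| < δ :=
    .forall_finite fun i => .lt (by fun_prop) (by fun_prop)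
  simpa only [Metric.mem_ball, dist_pi_lt_iff hδ, Real.dist_eq] using this

/-- The product of a partial diffeomorphism of `ℝⁿ` with an interval, sheared along the graph of a
function. -/
theorem DefDiffeo.exists_shear {r n : ℕ} {e : OpenPartialHomeomorph (Fin n → ℝ) (Fin n → ℝ)}
    (he : DefDiffeo L r e) {g : (Fin n → ℝ) → ℝ} (hg : DM L g) {O : Set (Fin n → ℝ)}
    (hO : IsOpen O) (hOd : DP L fun x => x ∈ O) (hgO : ContDiffOn ℝ r g O) (p q : ℝ) :
    ∃ e' : OpenPartialHomeomorph (Fin (n + 1) → ℝ) (Fin (n + 1) → ℝ), DefDiffeo L r e' ∧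
      (∀ x, x ∈ e'.source ↔ (Fin.init x ∈ e.source ∧ e (Fin.init x) ∈ O) ∧
        p < x (Fin.last n) ∧ x (Fin.last n) < q) ∧
      ∀ x, e' x = Fin.snoc (e (Fin.init x)) (x (Fin.last n) - g (e (Fin.init x))) := by
  set A : Set (Fin (n + 1) → ℝ) := {x | (Fin.init x ∈ e.source ∧ e (Fin.init x) ∈ O) ∧
        p < x (Fin.last n) ∧ x (Fin.last n) < q} with hA
  set B : Set (Fin (n + 1) → ℝ) := {y | (Fin.init y ∈ e.target ∧ Fin.init y ∈ O) ∧
        p < y (Fin.last n) + g (Fin.init y) ∧ y (Fin.last n) + g (Fin.init y) < q} with hB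
  have hinit : Continuous fun x : Fin (n + 1) → ℝ => (Fin.init x : Fin n → ℝ) :=
    contDiff_init (r := 0).continuous
  have hto : ContDiffOn ℝ r (fun x : Fin (n + 1) → ℝ => (Fin.snoc (e (Fin.init x))
      (x (Fin.last n) - g (e (Fin.init x))) : Fin (n + 1) → ℝ)) A := by
    have h1 : ContDiffOn ℝ r (fun x : Fin (n + 1) → ℝ => e (Fin.init x)) A :=
      he.contDiffOn.comp contDiff_init.contDiffOn fun x hx => hx.1.1
    exact contDiffOn_snoc h1 (contDiff_last.contDiffOn.sub (hgO.comp h1 fun x hx => hx.1.2))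
  have hinv : ContDiffOn ℝ r (fun y : Fin (n + 1) → ℝ => (Fin.snoc (e.symm (Fin.init y))
      (y (Fin.last n) + g (Fin.init y)) : Fin (n + 1) → ℝ)) B :=
    contDiffOn_snoc (he.contDiffOn_symm.comp contDiff_init.contDiffOn fun x hx => hx.1.1)
      (contDiff_last.contDiffOn.add (hgO.comp contDiff_init.contDiffOn fun x hx => hx.1.2))
  have hem := he.map
  have hems := he.map_symm
  refine ⟨{ toFun := fun x => Fin.snoc (e (Fin.init x)) (x (Fin.last n) - g (e (Fin.init x)))
            invFun := fun y => Fin.snoc (e.symm (Fin.init y)) (y (Fin.last n) + g (Fin.init y))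
            source := A
            target := B
            map_source' := ?_
            map_target' := ?_
            left_inv' := ?_
            right_inv' := ?_
            open_source := ?_
            open_target := ?_
            continuousOn_toFun := hto.continuousOn
            continuousOn_invFun := hinv.continuousOn },
    { source := ?_
      target := ?_
      map := by
        change DM L fun x : Fin (n + 1) → ℝ => (Fin.snoc (e (Fin.init x))
          (x (Fin.last n) - g (e (Fin.init x))) : Fin (n + 1) → ℝ)
        fun_prop
      map_symm := by
        change DM L fun y : Fin (n + 1) → ℝ => (Fin.snoc (e.symm (Fin.init y))
          (y (Fin.last n) + g (Fin.init y)) : Fin (n + 1) → ℝ)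
        fun_prop
      contDiffOn := hto
      contDiffOn_symm := hinv }, fun x => Iff.rfl, fun x => rfl⟩
  · rintro x ⟨⟨h1, h2⟩, h3⟩
    simp [hB, h1, h2, h3]
  · rintro x ⟨⟨h1, h2⟩, h3⟩
    simp [hA, h1, h2, h3]
  · rintro x ⟨⟨h1, h2⟩, h3⟩
    simp [h1]
  · rintro x ⟨⟨h1, h2⟩, h3⟩
    simp [h1]
  · have h1 : IsOpen {x : Fin (n + 1) → ℝ | Fin.init x ∈ e.source ∩ e ⁻¹' O} :=
      (e.continuousOn.isOpen_inter_preimage e.open_source hO).preimage hinit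
    exact h1.inter (isOpen_Ioo.preimage (continuous_apply (Fin.last n)))
  · have h1 : IsOpen {x : Fin (n + 1) → ℝ | Fin.init x ∈ e.target ∩ O} :=
      (e.open_target.inter hO).preimage hinit
    have h2 : ContinuousOn (fun y : Fin (n + 1) → ℝ => y (Fin.last n) + g (Fin.init y))
        {x : Fin (n + 1) → ℝ | Fin.init x ∈ e.target ∩ O} :=
      (continuous_apply _).continuousOn.add (hgO.continuousOn.comp hinit.continuousOn
        fun x hx => hx.2)
    exact h2.isOpen_inter_preimage h1 isOpen_Ioo
  · exact .and (.and (he.source.comp (by fun_prop)) (hOd.comp (by fun_prop)))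
      (.and (.lt (by fun_prop) (by fun_prop)) (.lt (by fun_prop) (by fun_prop)))
  · exact .and (.and (he.target.comp (by fun_prop)) (hOd.comp (by fun_prop)))
      (.and (.lt (by fun_prop) (by fun_prop)) (.lt (by fun_prop) (by fun_prop)))

end

section

theorem exists_dm_of_unique {P : E → ℝ → Prop} (hP : DP L fun p : E × ℝ => P p.1 p.2) :
    ∃ f : E → ℝ, DM L f ∧ ∀ x, (∃ t, P x t ∧ ∀ s, P x s → s = t) → ∀ t, P x t ↔ t = f x := by
  classical
  have hR : DP L fun x => ∃ t, P x t ∧ ∀ s, P x s → s = t :=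
    .exists (.and hP (.forall (.imp
      (hP.comp (f := fun x : (E × ℝ) × ℝ => (x.1.1, x.2)) (by fun_prop))
      (.eq .snd (by fun_prop)))))
  let f : E → ℝ := fun x => if h : ∃ t, P x t ∧ ∀ s, P x s → s = t then h.choose else 0
  have hf : ∀ x, (∃ t, P x t ∧ ∀ s, P x s → s = t) → ∀ t, P x t ↔ t = f x := by
    intro x h t
    have hs := h.choose_spec
    simp only [f, dif_pos h]
    exact ⟨fun ht => hs.2 t ht, fun ht => ht ▸ hs.1⟩
  refine ⟨f, .of_graph ?_, hf⟩
  have hg : DP L fun p : E × ℝ => ((∃ t, P p.1 t ∧ ∀ s, P p.1 s → s = t) ∧ P p.1 p.2) ∨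
      (¬ (∃ t, P p.1 t ∧ ∀ s, P p.1 s → s = t) ∧ p.2 = 0) :=
    .or (.and (hR.comp .fst) hP) (.and (hR.comp .fst).not (.eq .snd (.const 0)))
  convert hg using 2 with p
  by_cases h : ∃ t, P p.1 t ∧ ∀ s, P p.1 s → s = t
  · simp only [h, not_true, true_and, false_and, or_false]
    exact (hf _ h _).symm
  · simp only [h, not_false_iff, true_and, false_and, false_or]
    simp only [f, dif_neg h]

variable [hL : Fact (ExpandsOrderedField L)]

/-- Near some point, a nonempty definable set is a coordinate subspace in a definable `C^r`
chart. -/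
theorem LocallyOMinimal.exists_straight (hlom : LocallyOMinimal L) (r n : ℕ)
    {X : Set (Fin n → ℝ)} (hX : DP L fun x => x ∈ X) (hne : X.Nonempty) :
    ∃ (e : OpenPartialHomeomorph (Fin n → ℝ) (Fin n → ℝ)) (S : Finset (Fin n)),
      DefDiffeo L r e ∧ (X ∩ e.source).Nonempty ∧
        ∀ x ∈ e.source, x ∈ X ↔ ∀ i ∈ S, e x i = 0 := by
  induction n with
  | zero =>
    refine ⟨.refl _, ∅, .refl, by simpa using hne, fun x _ => ?_⟩
    obtain ⟨y, hy⟩ := hne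
    simpa [Subsingleton.elim x y] using hy
  | succ n ih =>
    obtain ⟨e, S, he, ⟨y₀, hy₀, hy₀s⟩, heS⟩ := ih (X := {y | ∃ t : ℝ, Fin.snoc y t ∈ X})
      (.exists (hX.comp (by fun_prop))) (by
        obtain ⟨x, hx⟩ := hne
        exact ⟨Fin.init x, x (Fin.last n), by simpa using hx⟩)
    have hem := he.map
    have hems := he.map_symm
    let Z : (Fin n → ℝ) → ℝ → Prop := fun v t => Fin.snoc (e.symm (zeroOn S v)) t ∈ X
    have hZ : DP L fun p : (Fin n → ℝ) × ℝ => Z p.1 p.2 := hX.comp (by fun_prop)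
    have hZne : ∀ v, zeroOn S v ∈ e.target → ∃ t, Z v t := fun v hv =>
      (heS _ (e.map_target hv)).2 fun i hi => by
        rw [e.right_inv hv, zeroOn_apply_mem hi]
    let D : ℚ × ℚ × Bool → (Fin n → ℝ) → Prop := fun k v => k.1 < k.2.1 ∧
      if k.2.2 then ∀ t : ℝ, k.1 < t → t < k.2.1 → Z v t
      else ∃ t : ℝ, ((k.1 < t ∧ t < k.2.1) ∧ Z v t) ∧
        ∀ s : ℝ, (k.1 < s ∧ s < k.2.1) ∧ Z v s → s = t
    have hD : ∀ k, DP L (D k) := by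
      rintro ⟨p, q, b⟩
      refine .and (.prop _) ?_
      cases b
      · have h : DP L fun x : (Fin n → ℝ) × ℝ => ((p : ℝ) < x.2 ∧ x.2 < q) ∧ Z x.1 x.2 :=
          .and (.and (.lt (.const _) .snd) (.lt .snd (.const _))) hZ
        exact .exists (.and h (.forall (.imp
          (h.comp (f := fun x : ((Fin n → ℝ) × ℝ) × ℝ => (x.1.1, x.2)) (by fun_prop))
          (.eq .snd (by fun_prop)))))
      · exact .forall (.imp (.lt (.const _) .snd) (.imp (.lt .snd (.const _)) hZ))
    obtain ⟨⟨p, q, b⟩, W, hWV, hW, ⟨w, hw⟩, hWD⟩ := (hlom.decides n).exists_of_countable hD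
      (e.open_target.preimage (contDiff_zeroOn (r := 0) S).continuous)
      ⟨e y₀, by
        rw [mem_preimage, zeroOn_eq_self ((heS _ hy₀s).1 hy₀)]
        exact e.map_source hy₀s⟩ fun v hv => by
          obtain ⟨p, q, hpq, h | h⟩ := hlom.exists_rat_interval_of_nonempty
            (X := Z v) (hZ.comp (f := fun t => (v, t)) (by fun_prop)) (hZne v hv)
          · exact ⟨(p, q, true), hpq, h⟩
          · exact ⟨(p, q, false), hpq, h⟩
    have hpq : (p : ℝ) < q := by exact_mod_cast (hWD w hw).1
    have key : ∀ w y t, y ∈ e.source → (Fin.snoc y t ∈ X ↔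
        (∀ i ∈ S, e y i = 0) ∧ Z (e y + (w - zeroOn S w)) t) := by
      intro w y t hy
      have h : (∀ i ∈ S, e y i = 0) → (Z (e y + (w - zeroOn S w)) t ↔ Fin.snoc y t ∈ X) :=
        fun h => by simp only [Z]; rw [zeroOn_add_sub_zeroOn w h, e.left_inv hy]
      refine ⟨fun hyt => ?_, fun ⟨h1, h2⟩ => (h h1).1 h2⟩
      have h1 := (heS y hy).1 ⟨t, hyt⟩
      exact ⟨h1, (h h1).2 hyt⟩
    obtain ⟨W', hWW', hW', ⟨w, hw⟩, g, hg, hgW, S', hS'⟩ : ∃ W' ⊆ W, IsOpen W' ∧ W'.Nonempty ∧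
        ∃ g : (Fin n → ℝ) → ℝ, DM L g ∧ ContDiffOn ℝ r g W' ∧ ∃ S' : Finset (Fin (n + 1)),
          ∀ v ∈ W', (∃ t : ℝ, (p < t ∧ t < q) ∧ Z v t) ∧ ∀ t : ℝ, p < t → t < q → ∀ y,
            ((∀ i ∈ S, y i = 0) ∧ Z v t ↔
              ∀ i ∈ S', (Fin.snoc y (t - g v) : Fin (n + 1) → ℝ) i = 0) := by
      cases b
      · obtain ⟨f, hf, hfZ⟩ := exists_dm_of_unique (L := L)
          (P := fun (v : Fin n → ℝ) (t : ℝ) => (p < t ∧ t < q) ∧ Z v t)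
          (.and (.and (.lt (.const _) .snd) (.lt .snd (.const _))) hZ)
        obtain ⟨W', hWW', hW', hne', hfW'⟩ := hlom.exists_contDiffOn r hf hW ⟨w, hw⟩
        refine ⟨W', hWW', hW', hne', f, hf, hfW',
          insert (Fin.last n) (S.map Fin.castSuccEmb), fun v hv => ?_⟩
        have huniq := (hWD v (hWW' hv)).2
        refine ⟨huniq.imp fun t ht => ht.1, fun t hp hq y => ?_⟩
        have := hfZ v huniq t
        simp only [hp, hq, true_and] at this
        simp [this, sub_eq_zero, and_comm]
      · refine ⟨W, subset_rfl, hW, ⟨w, hw⟩, fun _ => 0, .const _, contDiffOn_const,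
          S.map Fin.castSuccEmb, fun v hv => ?_⟩
        have hall : ∀ t : ℝ, p < t → t < q → Z v t := (hWD v hv).2
        refine ⟨⟨(p + q) / 2, ⟨by linarith, by linarith⟩,
          hall _ (by linarith) (by linarith)⟩, fun t hp hq y => ?_⟩
        simp [hall t hp hq]
    obtain ⟨δ, hδ, hball⟩ := Metric.isOpen_iff.1 hW' w hw
    have hadd : DM L fun v : Fin n → ℝ => v + (w - zeroOn S w) :=
      .pi fun i => .add (by fun_prop) (.const _)
    have hcont : ContDiff ℝ r fun v : Fin n → ℝ => v + (w - zeroOn S w) :=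
      contDiff_id.add contDiff_const
    obtain ⟨e', he', hs, hmap⟩ := he.exists_shear (hg.comp hadd)
      (O := (fun v => v + (w - zeroOn S w)) ⁻¹' Metric.ball w δ)
      (Metric.isOpen_ball.preimage hcont.continuous) ((DP.mem_ball w hδ).comp hadd)
      (hgW.comp hcont.contDiffOn fun v hv => hball hv) p q
    have hmem : ∀ x ∈ e'.source, x ∈ X ↔ ∀ i ∈ S', e' x i = 0 := by
      intro x hx
      obtain ⟨⟨hx1, hx2⟩, hx3, hx4⟩ := (hs x).1 hx
      rw [hmap, ← (hS' _ (hball hx2)).2 _ hx3 hx4, ← key w _ _ hx1, Fin.snoc_init_self]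
    obtain ⟨⟨t, ⟨hp, hq⟩, ht⟩, -⟩ := hS' w hw
    have hwt := hWV (hWW' hw)
    refine ⟨e', S', he', ⟨Fin.snoc (e.symm (zeroOn S w)) t, ht, ?_⟩, hmem⟩
    rw [hs, Fin.init_snoc, Fin.snoc_last, mem_preimage, e.right_inv hwt]
    exact ⟨⟨e.map_target hwt, by simpa⟩, hp, hq⟩

end

/-! ### Definable maps on definable sets -/

@[fun_prop]
theorem DM.fstFun {m n : ℕ} {f : E → Fin (m + n) → ℝ} (hf : DM L f) :
    DM L fun x => fstFun (f x) :=
  .pi fun i => DM.comp (DM.apply (Fin.castAdd n i)) hf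

@[fun_prop]
theorem DM.sndFun {m n : ℕ} {f : E → Fin (m + n) → ℝ} (hf : DM L f) :
    DM L fun x => sndFun (f x) :=
  .pi fun i => DM.comp (DM.apply (Fin.natAdd m i)) hf

@[fun_prop]
theorem DM.append {m n : ℕ} {f : E → Fin m → ℝ} {g : E → Fin n → ℝ} (hf : DM L f)
    (hg : DM L g) : DM L fun x => Fin.append (f x) (g x) :=
  .pi fun i => by
    refine Fin.addCases (fun i => ?_) (fun i => ?_) i
    · simpa using DM.comp (DM.apply i) hf
    · simpa using DM.comp (DM.apply i) hg

@[simp]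
theorem fstFun_append {m n : ℕ} (x : Fin m → ℝ) (y : Fin n → ℝ) : fstFun (Fin.append x y) = x := by
  ext i
  simp [fstFun]

@[simp]
theorem sndFun_append {m n : ℕ} (x : Fin m → ℝ) (y : Fin n → ℝ) : sndFun (Fin.append x y) = y := by
  ext i
  simp [sndFun]

theorem DM.defMapOn {m n : ℕ} {X : Set (Fin m → ℝ)} {f : (Fin m → ℝ) → Fin n → ℝ}
    (hf : DM L f) (hX : DP L fun x => x ∈ X) : DefMapOn L m n X f :=
  def_iff_dp.2 (.and (hX.comp (by fun_prop)) (.eq (by fun_prop) (by fun_prop)))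

theorem DefMapOn.exists_dm {m n : ℕ} {X : Set (Fin m → ℝ)} {f : (Fin m → ℝ) → Fin n → ℝ}
    (hf : DefMapOn L m n X f) (hX : DP L fun x => x ∈ X) :
    ∃ g : (Fin m → ℝ) → Fin n → ℝ, DM L g ∧ EqOn g f X := by
  classical
  refine ⟨fun x => if x ∈ X then f x else 0, .of_graph ?_, fun x hx => if_pos hx⟩
  have h : DP L fun p : (Fin m → ℝ) × (Fin n → ℝ) => p.1 ∈ X ∧ p.2 = f p.1 := by
    simpa using DP.comp (def_iff_dp.1 hf)
      (f := fun p : (Fin m → ℝ) × (Fin n → ℝ) => Fin.append p.1 p.2) (by fun_prop)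
  convert h.or (.and (hX.comp .fst).not (.eq .snd (.const 0))) using 2 with p
  split_ifs with hp <;> simp [hp]

theorem CrMapOn.contDiffOn_comp {r m n : ℕ} {X : Set (Fin m → ℝ)}
    {f : (Fin m → ℝ) → Fin n → ℝ} (hf : CrMapOn r m n X f) {F : Type*} [NormedAddCommGroup F]
    [NormedSpace ℝ F] {ρ : F → Fin m → ℝ} {A : Set F} (hρ : ContDiffOn ℝ r ρ A)
    (hA : MapsTo ρ A X) : ContDiffOn ℝ r (fun x => f (ρ x)) A := by
  intro x hx
  obtain ⟨W, g, hxW, hW, hg, hfg⟩ := hf _ (hA hx)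
  refine ((hg.contDiffAt (hW.mem_nhds hxW)).comp_contDiffWithinAt x (hρ x hx)).congr_of_eventuallyEq
    ?_ (hfg ⟨hA hx, hxW⟩)
  filter_upwards [(hρ.continuousOn x hx).preimage_mem_nhdsWithin (hW.mem_nhds hxW),
    self_mem_nhdsWithin] with y hy hyA
  exact hfg ⟨hA hyA, hy⟩

theorem CrMapOn.comp_contDiff {r m n k : ℕ} {X : Set (Fin m → ℝ)} {Y : Set (Fin k → ℝ)}
    {f : (Fin m → ℝ) → Fin n → ℝ} (hf : CrMapOn r m n X f) {ρ : (Fin k → ℝ) → Fin m → ℝ}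
    (hρ : ContDiff ℝ r ρ) (hY : MapsTo ρ Y X) : CrMapOn r k n Y fun x => f (ρ x) := by
  intro x hx
  obtain ⟨W, g, hxW, hW, hg, hfg⟩ := hf _ (hY hx)
  exact ⟨ρ ⁻¹' W, g ∘ ρ, hxW, hW.preimage hρ.continuous,
    hg.comp hρ.contDiffOn fun y hy => hy, fun y hy => hfg ⟨hY hy.1, hy.2⟩⟩

theorem CrMapOn.congr {r m n : ℕ} {X : Set (Fin m → ℝ)} {f g : (Fin m → ℝ) → Fin n → ℝ}
    (hf : CrMapOn r m n X f) (hfg : EqOn g f X) : CrMapOn r m n X g := by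
  intro x hx
  obtain ⟨W, k, hxW, hW, hk, hfk⟩ := hf x hx
  exact ⟨W, k, hxW, hW, hk, fun y hy => (hfg hy.1).trans (hfk hy)⟩

theorem CrMapOn.continuousOn {r m n : ℕ} {X : Set (Fin m → ℝ)} {f : (Fin m → ℝ) → Fin n → ℝ}
    (hf : CrMapOn r m n X f) : ContinuousOn f X := by
  intro x hx
  obtain ⟨W, g, hxW, hW, hg, hfg⟩ := hf x hx
  refine (hg.continuousOn.continuousAt (hW.mem_nhds hxW)).continuousWithinAt.congr_of_eventuallyEq
    ?_ (hfg ⟨hx, hxW⟩)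
  filter_upwards [mem_nhdsWithin_of_mem_nhds (hW.mem_nhds hxW), self_mem_nhdsWithin] with y hy hyX
  exact hfg ⟨hyX, hy⟩

theorem contDiff_append {r : WithTop ℕ∞} {m n : ℕ} {F : Type*} [NormedAddCommGroup F]
    [NormedSpace ℝ F] {f : F → Fin m → ℝ} {g : F → Fin n → ℝ} (hf : ContDiff ℝ r f)
    (hg : ContDiff ℝ r g) : ContDiff ℝ r fun x => Fin.append (f x) (g x) :=
  contDiff_pi.2 fun i => by
    refine Fin.addCases (fun i => ?_) (fun i => ?_) i
    · simpa using contDiff_pi.1 hf i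
    · simpa using contDiff_pi.1 hg i

/-! ### Charts -/

variable (L) in
/-- The definable `C^r` chart `e` straightens `M` to the vanishing of the coordinates in `S`. -/
structure IsChart (r : ℕ) {n : ℕ} (M : Set (Fin n → ℝ)) (S : Finset (Fin n))
    (e : OpenPartialHomeomorph (Fin n → ℝ) (Fin n → ℝ)) : Prop where
  defDiffeo : DefDiffeo L r e
  mem_iff : ∀ x ∈ e.source, x ∈ M ↔ ∀ i ∈ S, e x i = 0

theorem IsDefCrSubmanifold.exists_isChart {r n d : ℕ} {M : Set (Fin n → ℝ)}
    (hM : IsDefCrSubmanifold L r n d M) {a : Fin n → ℝ} (ha : a ∈ M) :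
    ∃ e : OpenPartialHomeomorph (Fin n → ℝ) (Fin n → ℝ), a ∈ e.source ∧
      IsChart L r M (Finset.univ.filter fun i : Fin n => d ≤ i) e := by
  obtain ⟨U, V, φ, ψ, haU, hU, hUd, -, hV, hVd, hφd, hψd, hφ, hψ, hbij, hinv, -, himg⟩ := hM.2 a ha
  obtain ⟨f, hf, hfφ⟩ := hφd.exists_dm hUd
  obtain ⟨g, hg, hgψ⟩ := hψd.exists_dm hVd
  have hmapsψ : MapsTo ψ V U := by
    rintro y hy
    obtain ⟨x, hx, rfl⟩ := hbij.surjOn hy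
    rwa [hinv.1 hx]
  refine ⟨{ toFun := f
            invFun := g
            source := U
            target := V
            map_source' := fun x hx => by rw [hfφ hx]; exact hbij.mapsTo hx
            map_target' := fun x hx => by rw [hgψ hx]; exact hmapsψ hx
            left_inv' := fun x hx => by rw [hfφ hx, hgψ (hbij.mapsTo hx), hinv.1 hx]
            right_inv' := fun x hx => by rw [hgψ hx, hfφ (hmapsψ hx), hinv.2 hx]
            open_source := hU
            open_target := hV
            continuousOn_toFun := hφ.continuousOn.congr hfφ
            continuousOn_invFun := hψ.continuousOn.congr hgψ }, haU,
    ⟨hUd, hVd, hf, hg, hφ.congr hfφ, hψ.congr hgψ⟩, fun x hx => ?_⟩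
  change x ∈ M ↔ ∀ i ∈ _, f x i = 0
  rw [hfφ hx]
  have hx' : φ x ∈ φ '' (M ∩ U) ↔ x ∈ M := by
    rw [hbij.injOn.mem_image_iff inter_subset_right hx, mem_inter_iff, and_iff_left hx]
  rw [← hx', himg]
  simp [hbij.mapsTo hx]

theorem isDefCrSubmanifold_of_isChart {r n : ℕ} {M : Set (Fin n → ℝ)} {S : Finset (Fin n)}
    [Fact (ExpandsOrderedField L)] (hM : Def L n M)
    (h : ∀ a ∈ M, ∃ e : OpenPartialHomeomorph (Fin n → ℝ) (Fin n → ℝ), a ∈ e.source ∧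
      IsChart L r M S e) : IsDefCrSubmanifold L r n (n - S.card) M := by
  refine ⟨hM, fun a ha => ?_⟩
  obtain ⟨e, hae, he⟩ := h a ha
  obtain ⟨σ, hσ⟩ : ∃ σ : Equiv.Perm (Fin n), ∀ i, σ i ∈ S ↔ n - S.card ≤ i := by
    have hcard : Fintype.card {i : Fin n // n - S.card ≤ i} = Fintype.card {i // i ∈ S} := by
      have h1 := Fin.card_filter_val_lt (n := n) (m := n - S.card)
      have h2 := Finset.card_filter_add_card_filter_not
        (s := Finset.univ) fun i : Fin n => (i : ℕ) < n - S.card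
      have h3 := S.card_le_univ
      rw [Fintype.card_coe, Fintype.card_subtype]
      simp only [not_lt, Finset.card_univ, Fintype.card_fin] at h2 h3
      omega
    obtain ⟨τ⟩ := Fintype.card_eq.1 hcard
    refine ⟨τ.extendSubtype, fun i => ⟨fun hi => ?_, fun hi => τ.extendSubtype_mem i hi⟩⟩
    by_contra hcon
    exact τ.extendSubtype_not_mem i hcon hi
  have hem := he.defDiffeo.map
  have hems := he.defDiffeo.map_symm
  set φ : (Fin n → ℝ) → Fin n → ℝ := fun x i => e x (σ i) - e a (σ i) with hφ
  set κ : (Fin n → ℝ) → Fin n → ℝ := fun y i => y (σ.symm i) + e a i with hκ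
  have hκd : DM L κ := .pi fun i => .add (by fun_prop) (.const _)
  have hκc : ContDiff ℝ r κ := contDiff_pi.2 fun i => (contDiff_apply ℝ ℝ _).add contDiff_const
  have hφd : DM L φ := .pi fun i => .sub (.comp (.apply _) hem) (.const _)
  have hκφ : ∀ x, κ (φ x) = e x := fun x => by ext i; simp [hκ, hφ]
  have hφκ : ∀ y, κ y ∈ e.target → φ (e.symm (κ y)) = y := fun y hy => by
    simp only [hφ, e.right_inv hy]
    ext i
    simp [hκ]
  have hVd : DP L fun y => y ∈ κ ⁻¹' e.target := he.defDiffeo.target.comp hκd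
  have hmap : MapsTo φ e.source (κ ⁻¹' e.target) := fun x hx => by
    rw [mem_preimage, hκφ]; exact e.map_source hx
  have hiff : ∀ x ∈ e.source, x ∈ M ↔ ∀ i : Fin n, n - S.card ≤ i → φ x i = 0 := by
    intro x hx
    have ha0 := (he.mem_iff a hae).1 ha
    rw [he.mem_iff x hx]
    refine ⟨fun h i hi => ?_, fun h i hi => ?_⟩
    · simp [hφ, h _ ((hσ i).2 hi), ha0 _ ((hσ i).2 hi)]
    · have := h (σ.symm i) ((hσ _).1 (by simpa using hi))
      simpa [hφ, ha0 i hi] using this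
  refine ⟨e.source, κ ⁻¹' e.target, φ, fun y => e.symm (κ y), hae, e.open_source,
    he.defDiffeo.source, ?_, e.open_target.preimage hκc.continuous, hVd,
    hφd.defMapOn he.defDiffeo.source, DM.defMapOn (.comp hems hκd) hVd,
    contDiffOn_pi.2 fun i => (contDiffOn_pi.1 he.defDiffeo.contDiffOn _).sub contDiffOn_const,
    he.defDiffeo.contDiffOn_symm.comp hκc.contDiffOn fun y hy => hy, ⟨hmap, ?_, ?_⟩,
    ⟨fun x hx => ?_, fun y hy => hφκ y hy⟩, ?_, ?_⟩
  · have : κ 0 = e a := by ext i; simp [hκ]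
    rw [mem_preimage, this]
    exact e.map_source hae
  · intro x hx y hy hxy
    exact e.injOn hx hy (by rw [← hκφ, hxy, hκφ])
  · exact fun y hy => ⟨e.symm (κ y), e.map_target hy, hφκ y hy⟩
  · simp only [hκφ]
    exact e.left_inv hx
  · ext i
    simp [hφ]
  · ext y
    constructor
    · rintro ⟨x, ⟨hxM, hx⟩, rfl⟩
      exact ⟨hmap hx, (hiff x hx).1 hxM⟩
    · rintro ⟨hy, h0⟩
      have hs := e.map_target hy
      refine ⟨e.symm (κ y), ⟨(hiff _ hs).2 ?_, hs⟩, hφκ y hy⟩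
      rwa [hφκ y hy]

/-! ### Transporting charts -/

section Transport

variable {r n : ℕ} {M : Set (Fin n → ℝ)} {S : Finset (Fin n)}
  {φ ψ : OpenPartialHomeomorph (Fin n → ℝ) (Fin n → ℝ)} {f g : (Fin n → ℝ) → Fin n → ℝ}

/-- A map `f : M → M` in terms of the coordinates given by charts `φ` and `ψ` of `M`, composed with
the projection onto the coordinate subspace corresponding to `M`. -/
def chartMap (S : Finset (Fin n)) (φ ψ : OpenPartialHomeomorph (Fin n → ℝ) (Fin n → ℝ))
    (f : (Fin n → ℝ) → Fin n → ℝ) (v : Fin n → ℝ) : Fin n → ℝ :=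
  ψ (f (φ.symm (zeroOn S v)))

/-- The domain of `chartMap S φ ψ f`. -/
def chartDomain (S : Finset (Fin n)) (φ ψ : OpenPartialHomeomorph (Fin n → ℝ) (Fin n → ℝ))
    (f : (Fin n → ℝ) → Fin n → ℝ) : Set (Fin n → ℝ) :=
  {v | zeroOn S v ∈ φ.target ∧ f (φ.symm (zeroOn S v)) ∈ ψ.source}

theorem IsChart.symm_zeroOn_mem (hφ : IsChart L r M S φ) {v : Fin n → ℝ}
    (hv : zeroOn S v ∈ φ.target) : φ.symm (zeroOn S v) ∈ M :=
  (hφ.mem_iff _ (φ.map_target hv)).2 fun i hi => by rw [φ.right_inv hv, zeroOn_apply_mem hi]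

theorem IsChart.contDiffOn_symm_zeroOn (hφ : IsChart L r M S φ) :
    ContDiffOn ℝ r (fun v => φ.symm (zeroOn S v)) (zeroOn S ⁻¹' φ.target) :=
  hφ.defDiffeo.contDiffOn_symm.comp (contDiff_zeroOn S).contDiffOn fun _ hv => hv

theorem IsChart.contDiffOn_comp (hφ : IsChart L r M S φ) (hf : CrMapOn r n n M f) :
    ContDiffOn ℝ r (fun v => f (φ.symm (zeroOn S v))) (zeroOn S ⁻¹' φ.target) :=
  hf.contDiffOn_comp hφ.contDiffOn_symm_zeroOn fun _ hv => hφ.symm_zeroOn_mem hv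

theorem isOpen_chartDomain (hφ : IsChart L r M S φ) (hf : CrMapOn r n n M f) :
    IsOpen (chartDomain S φ ψ f) :=
  (hφ.contDiffOn_comp hf).continuousOn.isOpen_inter_preimage
    (φ.open_target.preimage (contDiff_zeroOn (r := 0) S).continuous) ψ.open_source

theorem DP.mem_chartDomain (hφ : IsChart L r M S φ) (hψ : IsChart L r M S ψ) (hf : DM L f) :
    DP L fun v => v ∈ chartDomain S φ ψ f := by
  have := hφ.defDiffeo.map_symm
  exact .and (hφ.defDiffeo.target.comp (by fun_prop)) (hψ.defDiffeo.source.comp (by fun_prop))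

theorem DM.chartMap (hφ : IsChart L r M S φ) (hψ : IsChart L r M S ψ) (hf : DM L f) :
    DM L (chartMap S φ ψ f) :=
  hψ.defDiffeo.map.comp (hf.comp (hφ.defDiffeo.map_symm.comp (.zeroOn .id)))

theorem contDiffOn_chartMap (hφ : IsChart L r M S φ) (hψ : IsChart L r M S ψ)
    (hf : CrMapOn r n n M f) : ContDiffOn ℝ r (chartMap S φ ψ f) (chartDomain S φ ψ f) :=
  hψ.defDiffeo.contDiffOn.comp ((hφ.contDiffOn_comp hf).mono fun _ hv => hv.1) fun _ hv => hv.2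

theorem chartMap_apply_mem (hφ : IsChart L r M S φ) (hψ : IsChart L r M S ψ) (hf : MapsTo f M M)
    {v : Fin n → ℝ} (hv : v ∈ chartDomain S φ ψ f) : ∀ i ∈ S, chartMap S φ ψ f v i = 0 :=
  (hψ.mem_iff _ hv.2).1 (hf (hφ.symm_zeroOn_mem hv.1))

/-- The extension of `chartMap S φ ψ f` by the identity on the coordinates in `S`. -/
def chartExtend (S : Finset (Fin n)) (φ ψ : OpenPartialHomeomorph (Fin n → ℝ) (Fin n → ℝ))
    (f : (Fin n → ℝ) → Fin n → ℝ) (v : Fin n → ℝ) : Fin n → ℝ :=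
  chartMap S φ ψ f v + (v - zeroOn S v)

theorem contDiffOn_chartExtend (hφ : IsChart L r M S φ) (hψ : IsChart L r M S ψ)
    (hf : CrMapOn r n n M f) : ContDiffOn ℝ r (chartExtend S φ ψ f) (chartDomain S φ ψ f) :=
  (contDiffOn_chartMap hφ hψ hf).add (contDiff_id.sub (contDiff_zeroOn S)).contDiffOn

theorem zeroOn_chartExtend (hφ : IsChart L r M S φ) (hψ : IsChart L r M S ψ) (hf : MapsTo f M M)
    {v : Fin n → ℝ} (hv : v ∈ chartDomain S φ ψ f) :
    zeroOn S (chartExtend S φ ψ f v) = chartMap S φ ψ f v :=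
  zeroOn_add_sub_zeroOn v (chartMap_apply_mem hφ hψ hf hv)

theorem symm_zeroOn_chartExtend (hφ : IsChart L r M S φ) (hψ : IsChart L r M S ψ)
    (hf : MapsTo f M M) (hgf : ∀ x ∈ M, g (f x) = x) {v : Fin n → ℝ}
    (hv : v ∈ chartDomain S φ ψ f) :
    g (ψ.symm (zeroOn S (chartExtend S φ ψ f v))) = φ.symm (zeroOn S v) := by
  rw [zeroOn_chartExtend hφ hψ hf hv, chartMap, ψ.left_inv hv.2, hgf _ (hφ.symm_zeroOn_mem hv.1)]

theorem mapsTo_chartExtend (hφ : IsChart L r M S φ) (hψ : IsChart L r M S ψ)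
    (hf : MapsTo f M M) (hgf : ∀ x ∈ M, g (f x) = x) :
    MapsTo (chartExtend S φ ψ f) (chartDomain S φ ψ f) (chartDomain S ψ φ g) := by
  intro v hv
  refine ⟨?_, ?_⟩
  · rw [zeroOn_chartExtend hφ hψ hf hv]
    exact ψ.map_source hv.2
  · rw [symm_zeroOn_chartExtend hφ hψ hf hgf hv]
    exact φ.map_target hv.1

theorem chartExtend_chartExtend (hφ : IsChart L r M S φ) (hψ : IsChart L r M S ψ)
    (hf : MapsTo f M M) (hgf : ∀ x ∈ M, g (f x) = x) {v : Fin n → ℝ}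
    (hv : v ∈ chartDomain S φ ψ f) :
    chartExtend S ψ φ g (chartExtend S φ ψ f v) = v := by
  have h1 : chartMap S ψ φ g (chartExtend S φ ψ f v) = zeroOn S v := by
    rw [chartMap, symm_zeroOn_chartExtend hφ hψ hf hgf hv, φ.right_inv hv.1]
  rw [chartExtend, h1, zeroOn_chartExtend hφ hψ hf hv, chartExtend]
  abel

theorem DM.chartExtend [Fact (ExpandsOrderedField L)] (hφ : IsChart L r M S φ)
    (hψ : IsChart L r M S ψ) (hf : DM L f) : DM L (chartExtend S φ ψ f) := by
  have := DM.chartMap hφ hψ hf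
  have hz : DM L (Paper.zeroOn S) := .zeroOn .id
  exact .pi fun i => .add (.comp (.apply i) this)
    (.sub (.apply i) (.comp (g := fun w => w i) (.apply i) hz))

/-- A definable `C^r` automorphism of `M` extends, near each point, to a definable `C^r`
diffeomorphism of the ambient space preserving `M`. -/
theorem exists_defDiffeo_extending [Fact (ExpandsOrderedField L)] (hφ : IsChart L r M S φ)
    (hψ : IsChart L r M S ψ) (hf : DM L f) (hg : DM L g) (hfr : CrMapOn r n n M f)
    (hgr : CrMapOn r n n M g) (hfM : MapsTo f M M) (hgM : MapsTo g M M)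
    (hgf : ∀ x ∈ M, g (f x) = x) (hfg : ∀ x ∈ M, f (g x) = x) {h : Fin n → ℝ} (hhM : h ∈ M)
    (hh : h ∈ φ.source) (hfh : f h ∈ ψ.source) :
    ∃ Φ : OpenPartialHomeomorph (Fin n → ℝ) (Fin n → ℝ), DefDiffeo L r Φ ∧ h ∈ Φ.source ∧
      ∀ x ∈ Φ.source, (x ∈ M → Φ x = f x) ∧ (Φ x ∈ M → x ∈ M) := by
  let T : OpenPartialHomeomorph (Fin n → ℝ) (Fin n → ℝ) :=
    { toFun := chartExtend S φ ψ f
      invFun := chartExtend S ψ φ g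
      source := chartDomain S φ ψ f
      target := chartDomain S ψ φ g
      map_source' := fun v hv => mapsTo_chartExtend hφ hψ hfM hgf hv
      map_target' := fun v hv => mapsTo_chartExtend hψ hφ hgM hfg hv
      left_inv' := fun v hv => chartExtend_chartExtend hφ hψ hfM hgf hv
      right_inv' := fun v hv => chartExtend_chartExtend hψ hφ hgM hfg hv
      open_source := isOpen_chartDomain hφ hfr
      open_target := isOpen_chartDomain hψ hgr
      continuousOn_toFun := (contDiffOn_chartExtend hφ hψ hfr).continuousOn
      continuousOn_invFun := (contDiffOn_chartExtend hψ hφ hgr).continuousOn }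
  have hT : DefDiffeo L r T :=
    { source := .mem_chartDomain hφ hψ hf
      target := .mem_chartDomain hψ hφ hg
      map := .chartExtend hφ hψ hf
      map_symm := .chartExtend hψ hφ hg
      contDiffOn := contDiffOn_chartExtend hφ hψ hfr
      contDiffOn_symm := contDiffOn_chartExtend hψ hφ hgr }
  have hz : ∀ x ∈ φ.source, x ∈ M → zeroOn S (φ x) = φ x := fun x hx hxM =>
    zeroOn_eq_self ((hφ.mem_iff x hx).1 hxM)
  have hTφ : ∀ x ∈ φ.source, x ∈ M → T (φ x) = ψ (f x) := fun x hx hxM => by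
    change chartExtend S φ ψ f (φ x) = _
    rw [chartExtend, chartMap, hz x hx hxM, φ.left_inv hx, sub_self, add_zero]
  refine ⟨(φ.trans T).trans ψ.symm, (hφ.defDiffeo.trans hT).trans hψ.defDiffeo.symm, ?_,
    fun x hx => ?_⟩
  · simp only [OpenPartialHomeomorph.trans_source, mem_inter_iff, mem_preimage,
      OpenPartialHomeomorph.symm_source, OpenPartialHomeomorph.coe_trans, Function.comp_apply]
    refine ⟨⟨hh, ?_, ?_⟩, ?_⟩
    · rw [hz h hh hhM]
      exact φ.map_source hh
    · rwa [hz h hh hhM, φ.left_inv hh]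
    · rw [hTφ h hh hhM]
      exact ψ.map_source hfh
  · simp only [OpenPartialHomeomorph.trans_source, mem_inter_iff, mem_preimage,
      OpenPartialHomeomorph.symm_source, OpenPartialHomeomorph.coe_trans,
      Function.comp_apply] at hx
    obtain ⟨⟨hx1, hx2⟩, hx3⟩ := hx
    simp only [OpenPartialHomeomorph.coe_trans, Function.comp_apply]
    refine ⟨fun hxM => ?_, fun hM => ?_⟩
    · have h2 : f (φ.symm (zeroOn S (φ x))) ∈ ψ.source := hx2.2
      rw [hz x hx1 hxM, φ.left_inv hx1] at h2
      rw [hTφ x hx1 hxM, ψ.left_inv h2]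
    · rw [hψ.mem_iff _ (ψ.map_target hx3), ψ.right_inv hx3] at hM
      refine (hφ.mem_iff x hx1).2 fun i hi => ?_
      have h1 : chartMap S φ ψ f (φ x) i + (φ x i - zeroOn S (φ x) i) = 0 := hM i hi
      simpa [chartMap_apply_mem hφ hψ hfM hx2 i hi, zeroOn_apply_mem hi] using h1

end Transport

theorem IsChart.mem_of_mem_closure {r n : ℕ} {M : Set (Fin n → ℝ)} {S : Finset (Fin n)}
    {e : OpenPartialHomeomorph (Fin n → ℝ) (Fin n → ℝ)} (he : IsChart L r M S e) {x : Fin n → ℝ}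
    (hx : x ∈ e.source) (hxM : x ∈ closure M) : x ∈ M := by
  refine (he.mem_iff x hx).2 fun i hi => ?_
  by_contra hne
  have hc : ContinuousAt (fun y => e y i) x :=
    (continuous_apply i).continuousAt.comp (e.continuousAt hx)
  obtain ⟨y, ⟨hy1, hy2⟩, hyM⟩ := mem_closure_iff_nhds.1 hxM _
    (Filter.inter_mem (hc.eventually_ne hne) (e.open_source.mem_nhds hx))
  exact hy1 ((he.mem_iff y hy2).1 hyM i hi)

end Helpers

/-- a definable subgroup of a definable `C^r` group `G ⊆ ℝ^N` is closed in
`G` and is itself a definable `C^r` submanifold of `ℝ^N`. -/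
theorem statement10
    (hfield : ExpandsOrderedField L) (hlom : LocallyOMinimal L)
    (r : ℕ) (hr : 1 ≤ r) (N dG : ℕ)
    (G : Set (Fin N → ℝ)) (hG : IsDefCrSubmanifold L r N dG G)
    (mul : (Fin N → ℝ) → (Fin N → ℝ) → (Fin N → ℝ))
    (inv : (Fin N → ℝ) → (Fin N → ℝ)) (e : Fin N → ℝ)
    (he : e ∈ G)
    (hmul_mem : ∀ x ∈ G, ∀ y ∈ G, mul x y ∈ G)
    (hinv_mem : ∀ x ∈ G, inv x ∈ G)
    (hassoc : ∀ x ∈ G, ∀ y ∈ G, ∀ z ∈ G, mul (mul x y) z = mul x (mul y z))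
    (hident : ∀ x ∈ G, mul e x = x ∧ mul x e = x)
    (hinverse : ∀ x ∈ G, mul x (inv x) = e ∧ mul (inv x) x = e)
    (hmul_cr : DefCrMapOn L r (N + N) N {z | fstFun z ∈ G ∧ sndFun z ∈ G}
      (fun z => mul (fstFun z) (sndFun z)))
    (hinv_cr : DefCrMapOn L r N N G inv)
    (H : Set (Fin N → ℝ)) (hHdef : Def L N H) (hHG : H ⊆ G)
    (heH : e ∈ H)
    (hHmul : ∀ x ∈ H, ∀ y ∈ H, mul x y ∈ H)
    (hHinv : ∀ x ∈ H, inv x ∈ H) :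
    (∃ C : Set (Fin N → ℝ), IsClosed C ∧ H = G ∩ C) ∧
    ∃ dH : ℕ, IsDefCrSubmanifold L r N dH H := by
  have : Fact (ExpandsOrderedField L) := ⟨hfield⟩
  have hGd : DP L fun x => x ∈ G := hG.1
  have hHd : DP L fun x => x ∈ H := hHdef
  -- left translations
  have htrans : ∀ τ ∈ G, ∃ f : (Fin N → ℝ) → Fin N → ℝ, DM L f ∧ EqOn f (mul τ) G ∧
      CrMapOn r N N G f := by
    intro τ hτ
    obtain ⟨m, hm, hmul⟩ := hmul_cr.1.exists_dm
      (.and (hGd.comp (by fun_prop)) (hGd.comp (by fun_prop)))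
    have hmem : MapsTo (fun x => Fin.append τ x) G {z | fstFun z ∈ G ∧ sndFun z ∈ G} :=
      fun x hx => by simp [hτ, hx]
    have heq : EqOn (fun x => m (Fin.append τ x)) (mul τ) G := fun x hx => by
      simpa using hmul (hmem hx)
    refine ⟨fun x => m (Fin.append τ x), hm.comp (.append (.const τ) .id), heq, ?_⟩
    exact (hmul_cr.2.comp_contDiff (contDiff_append contDiff_const contDiff_id) hmem).congr
      fun x hx => hmul (hmem hx)
  have hcancel : ∀ τ ∈ G, ∀ x ∈ G, mul (inv τ) (mul τ x) = x ∧ mul τ (mul (inv τ) x) = x :=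
    fun τ hτ x hx => by
      rw [← hassoc _ (hinv_mem τ hτ) _ hτ _ hx, ← hassoc _ hτ _ (hinv_mem τ hτ) _ hx,
        (hinverse τ hτ).1, (hinverse τ hτ).2, (hident x hx).1]
      exact ⟨rfl, rfl⟩
  have hHiff : ∀ τ ∈ H, ∀ x ∈ G, mul τ x ∈ H ↔ x ∈ H := fun τ hτ x hx =>
    ⟨fun h => (hcancel τ (hHG hτ) x hx).1 ▸ hHmul _ (hHinv τ hτ) _ h, fun h => hHmul τ hτ x h⟩
  obtain ⟨e₀, S, he₀, ⟨a, haH, ha⟩, hS⟩ := hlom.exists_straight r N hHd ⟨e, heH⟩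
  have hchart : IsChart L r H S e₀ := ⟨he₀, hS⟩
  have haG := hHG haH
  refine ⟨⟨closure H, isClosed_closure, ?_⟩, N - S.card, ?_⟩
  · refine subset_antisymm (fun x hx => ⟨hHG hx, subset_closure hx⟩) fun x ⟨hxG, hx⟩ => ?_
    -- the map `y ↦ a y⁻¹ x` is continuous on `G` and sends `x` to `a`
    have hcont : ContinuousOn (fun y => mul (mul a (inv y)) x) G := by
      obtain ⟨f, -, hf, hfr⟩ := htrans a haG
      have h1 : ContinuousOn (fun y => mul a (inv y)) G :=
        (hfr.continuousOn.comp hinv_cr.2.continuousOn hinv_mem).congr fun y hy =>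
          (hf (hinv_mem y hy)).symm
      have h2 : ContinuousOn (fun y => (Fin.append (mul a (inv y)) x : Fin (N + N) → ℝ)) G :=
        (contDiff_append (r := 0) contDiff_id contDiff_const).continuous.comp_continuousOn h1
      have h3 := hmul_cr.2.continuousOn.comp h2 fun y hy => by
        simp [hxG, hmul_mem _ haG _ (hinv_mem y hy)]
      simpa [Function.comp_def] using h3
    have hax : mul (mul a (inv x)) x = a := by
      rw [hassoc _ haG _ (hinv_mem x hxG) _ hxG, (hinverse x hxG).2, (hident a haG).2]
    have hnhds : ∀ᶠ y in 𝓝[H] x, mul (mul a (inv y)) x ∈ e₀.source :=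
      ((hcont x hxG).mono hHG).eventually (by
        simp only [hax]
        exact e₀.open_source.mem_nhds ha)
    have : (𝓝[H] x).NeBot := mem_closure_iff_nhdsWithin_neBot.1 hx
    obtain ⟨h, hh, hhH⟩ := (hnhds.and self_mem_nhdsWithin).exists
    have hτ : mul a (inv h) ∈ H := hHmul _ haH _ (hHinv _ hhH)
    obtain ⟨f, -, hf, hfr⟩ := htrans _ (hHG hτ)
    have hclosure : f x ∈ closure H :=
      ((hfr.continuousOn x hxG).mono hHG).mem_closure hx fun y hy => by
        rw [hf (hHG hy)]
        exact hHmul _ hτ _ hy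
    rw [hf hxG] at hclosure
    exact (hHiff _ hτ x hxG).1 (hchart.mem_of_mem_closure hh hclosure)
  · refine isDefCrSubmanifold_of_isChart hHdef fun h hh => ?_
    have hhG := hHG hh
    have hτ : mul a (inv h) ∈ H := hHmul _ haH _ (hHinv _ hh)
    have hτG := hHG hτ
    obtain ⟨f, hf, hfeq, hfr⟩ := htrans _ hτG
    obtain ⟨g, hg, hgeq, hgr⟩ := htrans _ (hinv_mem _ hτG)
    obtain ⟨φ, hhφ, hφ⟩ := hG.exists_isChart hhG
    obtain ⟨ψ, haψ, hψ⟩ := hG.exists_isChart haG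
    have hfG : MapsTo f G G := fun x hx => by
      rw [hfeq hx]
      exact hmul_mem _ hτG _ hx
    have hgG : MapsTo g G G := fun x hx => by
      rw [hgeq hx]
      exact hmul_mem _ (hinv_mem _ hτG) _ hx
    have hfh : f h = a := by
      rw [hfeq hhG, hassoc _ haG _ (hinv_mem h hhG) _ hhG, (hinverse h hhG).2, (hident a haG).2]
    obtain ⟨Φ, hΦ, hhΦ, hΦG⟩ := exists_defDiffeo_extending hφ hψ hf hg hfr hgr hfG hgG
      (fun x hx => by rw [hgeq (hfG hx), hfeq hx, (hcancel _ hτG x hx).1])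
      (fun x hx => by rw [hfeq (hgG hx), hgeq hx, (hcancel _ hτG x hx).2]) hhG hhφ
      (by rwa [hfh])
    refine ⟨Φ.trans e₀, ?_, hΦ.trans he₀, fun x hx => ?_⟩
    · rw [OpenPartialHomeomorph.trans_source]
      refine ⟨hhΦ, ?_⟩
      rwa [mem_preimage, (hΦG h hhΦ).1 hhG, hfh]
    · rw [OpenPartialHomeomorph.trans_source] at hx
      rw [OpenPartialHomeomorph.coe_trans, Function.comp_apply, ← hS _ hx.2]
      by_cases hxG : x ∈ G
      · rw [(hΦG x hx.1).1 hxG, hfeq hxG, hHiff _ hτ x hxG]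
      · exact ⟨fun h => absurd (hHG h) hxG, fun h => absurd ((hΦG x hx.1).2 (hHG h)) hxG⟩

end Paper
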